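/- For every integer n ≥ 3 and every ε > 0 there exists a bounded domain K ⊆ ℝⁿ with smooth boundary which is a C¹ ε-perturbation of a ball and satisfies ∫_{∂K} H dH^{n-1} < −1. -/

import Mathlib

open MeasureTheory Metric Set Real
open scoped ENNReal RealInnerProductSpace

noncomputable section

abbrev Euc (n : ℕ) := EuclideanSpace ℝ (Fin n)

/-- Divergence of a vector field on Euclidean space: trace of its Fréchet derivative. -/
def divg {n : ℕ} (W : Euc n → Euc n) (x : Euc n) : ℝ :=
  LinearMap.trace ℝ (Euc n) (fderiv ℝ W x).toLinearMap

/-- A bounded domain with smooth boundary, encoded by a smooth defining function `F`: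
the domain is `{F < 0}` and its boundary is `{F = 0}`, on which `0` is a regular value. -/
structure SmoothBody (n : ℕ) where
  F : Euc n → ℝ
  smooth : ContDiff ℝ (⊤ : ℕ∞) F
  bounded : Bornology.IsBounded {x : Euc n | F x ≤ 0}
  connected : IsConnected {x : Euc n | F x < 0}
  regular : ∀ x : Euc n, F x = 0 → gradient F x ≠ 0

namespace SmoothBody

variable {n : ℕ} (K : SmoothBody n)

/-- The (open) domain `K`. -/
def body : Set (Euc n) := {x : Euc n | K.F x < 0}

/-- The boundary `∂K`. -/
def bdry : Set (Euc n) := {x : Euc n | K.F x = 0}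

/-- The outer unit normal to `∂K` (extended to a neighbourhood as the normalized
gradient of the defining function). -/
def normal (x : Euc n) : Euc n := ‖gradient K.F x‖⁻¹ • gradient K.F x

/-- The mean curvature of `∂K` (trace of the second fundamental form with respect to the
outer unit normal), computed as the divergence of the unit normal field. -/
def meanCurv (x : Euc n) : ℝ := divg K.normal x

/-- The orthogonal projection onto the hyperplane orthogonal to `ν`, as a linear map. -/
def tangentProj (ν : Euc n) : Euc n →ₗ[ℝ] Euc n :=
  LinearMap.id - LinearMap.smulRight (innerSL ℝ ν).toLinearMap ν

/-- The shape operator (Weingarten map) of `∂K` at `x`, extended by `0` on the normal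
direction: `P ∘ Dν ∘ P` with `P` the orthogonal projection on the tangent space
`(ν x)^⊥` of `∂K`. Its eigenvalues are the principal curvatures of `∂K` together
with one extra `0`. -/
def shapeOp (x : Euc n) : Euc n →ₗ[ℝ] Euc n :=
  (tangentProj (K.normal x)) ∘ₗ (fderiv ℝ K.normal x).toLinearMap ∘ₗ (tangentProj (K.normal x))

/-- The nuclear norm `‖II‖₁` of the second fundamental form of `∂K` at `x`: the sum of the
absolute values of the principal curvatures (eigenvalues of the shape operator). -/
def nuclearNormII (x : Euc n) : ℝ :=
  let M := LinearMap.toMatrix (EuclideanSpace.basisFun (Fin n) ℝ).toBasis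
      (EuclideanSpace.basisFun (Fin n) ℝ).toBasis (K.shapeOp x)
  if h : M.IsHermitian then ∑ i, |h.eigenvalues i| else 0

/-- The perimeter of `K`: the `(n-1)`-dimensional Hausdorff measure of `∂K`. -/
def perim : ℝ := (μH[(n : ℝ) - 1] K.bdry).toReal

/-- `K` is a `C¹` `ε`-perturbation of a ball: for some `x̄ ∈ ℝⁿ`, the outer unit normal
satisfies `|ν(x) - (x - x̄)/|x - x̄|| ≤ ε` for every `x ∈ ∂K`. -/
def IsPerturbedBall (ε : ℝ) : Prop :=
  ∃ c : Euc n, ∀ x ∈ K.bdry, ‖K.normal x - ‖x - c‖⁻¹ • (x - c)‖ ≤ ε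

end SmoothBody

/-- The area of the unit sphere `S^{n-1} ⊆ ℝⁿ`, i.e. its `(n-1)`-dimensional Hausdorff
measure (which is also the perimeter of the unit ball `B₁`). -/
def sphereArea (n : ℕ) : ℝ := (μH[(n : ℝ) - 1] (sphere (0 : Euc n) 1)).toReal

open Module Filter Topology
open scoped NNReal Gradient ContDiff

section GraphArea

set_option linter.unusedSectionVars false

variable {E X : Type*} [NormedAddCommGroup E] [InnerProductSpace ℝ E] [FiniteDimensional ℝ E]
  [NormedAddCommGroup X] [InnerProductSpace ℝ X] [FiniteDimensional ℝ X]

/-- Parametrization of the graph of `w : E → ℝ` in `X`, where `E` is embedded in `X` via `ι`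
and `e` is the vertical direction. -/
def graphMap (ι : E →ₗᵢ[ℝ] X) (e : X) (w : E → ℝ) (y : E) : X := ι y + w y • e

/-- The derivative of `graphMap ι e w` at a point where `w` has gradient `g`. -/
def graphLin (ι : E →ₗᵢ[ℝ] X) (e : X) (g : E) : E →L[ℝ] X :=
  ι.toContinuousLinearMap + (innerSL ℝ g).smulRight e

lemma graphLin_apply (ι : E →ₗᵢ[ℝ] X) (e : X) (g y : E) :
    graphLin ι e g y = ι y + ⟪g, y⟫ • e := rfl

lemma inner_graphLin (ι : E →ₗᵢ[ℝ] X) {e : X} (he : ‖e‖ = 1) (hι : ∀ y, ⟪ι y, e⟫ = 0)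
    (g y z : E) : ⟪graphLin ι e g y, graphLin ι e g z⟫ = ⟪y, z⟫ + ⟪g, y⟫ * ⟪g, z⟫ := by
  have hι' : ∀ y, ⟪e, ι y⟫ = 0 := fun y => by rw [real_inner_comm]; exact hι y
  simp only [graphLin_apply, inner_add_left, inner_add_right, inner_smul_left, inner_smul_right,
    hι, hι', LinearIsometry.inner_map_map, real_inner_self_eq_norm_sq, he]
  simp [mul_comm]

lemma normDet_graphLin (ι : E →ₗᵢ[ℝ] X) {e : X} (he : ‖e‖ = 1) (hι : ∀ y, ⟪ι y, e⟫ = 0)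
    (g : E) : (graphLin ι e g).toLinearMap.normDet = √(1 + ‖g‖ ^ 2) := by
  have h := LinearMap.normDet_sq (graphLin ι e g).toLinearMap
  have h2 : (graphLin ι e g).toLinearMap.adjoint ∘ₗ (graphLin ι e g).toLinearMap =
      LinearMap.transvection (innerSL ℝ g).toLinearMap g := by
    ext y
    refine ext_inner_right ℝ fun z => ?_
    rw [LinearMap.comp_apply, LinearMap.adjoint_inner_left]
    simp only [ContinuousLinearMap.coe_coe]
    rw [inner_graphLin ι he hι]
    simp [LinearMap.transvection, inner_add_left, inner_smul_left]
  rw [h2, LinearMap.transvection.det] at h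
  rw [← Real.sqrt_sq (LinearMap.normDet_nonneg _)]
  congr 1
  simpa using h

lemma norm_le_norm_graphLin (ι : E →ₗᵢ[ℝ] X) {e : X} (he : ‖e‖ = 1) (hι : ∀ y, ⟪ι y, e⟫ = 0)
    (g y : E) : ‖y‖ ≤ ‖graphLin ι e g y‖ := by
  have h := inner_graphLin ι he hι g y y
  rw [real_inner_self_eq_norm_sq, real_inner_self_eq_norm_sq] at h
  refine le_of_sq_le_sq ?_ (norm_nonneg _)
  nlinarith [mul_self_nonneg ⟪g, y⟫]

lemma norm_sub_le_norm_graphMap_sub (ι : E →ₗᵢ[ℝ] X) {e : X} (he : ‖e‖ = 1)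
    (hι : ∀ y, ⟪ι y, e⟫ = 0) (w : E → ℝ) (y z : E) :
    ‖y - z‖ ≤ ‖graphMap ι e w y - graphMap ι e w z‖ := by
  have h : graphMap ι e w y - graphMap ι e w z = ι (y - z) + (w y - w z) • e := by
    simp only [graphMap, map_sub, sub_smul]; abel
  have h2 : ‖ι (y - z) + (w y - w z) • e‖ ^ 2 = ‖y - z‖ ^ 2 + (w y - w z) ^ 2 := by
    rw [norm_add_sq_real, inner_smul_right, hι, norm_smul, he, LinearIsometry.norm_map]
    simp
  rw [h]
  refine le_of_sq_le_sq ?_ (norm_nonneg _)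
  nlinarith [sq_nonneg (w y - w z)]

lemma graphMap_injective (ι : E →ₗᵢ[ℝ] X) {e : X} (he : ‖e‖ = 1)
    (hι : ∀ y, ⟪ι y, e⟫ = 0) (w : E → ℝ) : Function.Injective (graphMap ι e w) := by
  intro y z h
  have := norm_sub_le_norm_graphMap_sub ι he hι w y z
  rw [h, sub_self, norm_zero] at this
  exact sub_eq_zero.1 (norm_eq_zero.1 (le_antisymm this (norm_nonneg _)))

variable [MeasurableSpace E] [BorelSpace E] [MeasurableSpace X] [BorelSpace X]

/-- If two maps on a set are comparable up to a multiplicative constant, so are the Hausdorff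
measures of the images. -/
lemma hausdorffMeasure_image_le_of_dist_le {S Y Z : Type*} [EMetricSpace Y] [EMetricSpace Z]
    [MeasurableSpace Y] [BorelSpace Y] [MeasurableSpace Z] [BorelSpace Z]
    {f : S → Y} {g : S → Z} {A : Set S} {C : ℝ≥0} {d : ℝ} (hd : 0 ≤ d)
    (hf : Function.Injective f)
    (h : ∀ y ∈ A, ∀ z ∈ A, edist (g y) (g z) ≤ C * edist (f y) (f z)) :
    μH[d] (g '' A) ≤ (C : ℝ≥0∞) ^ d * μH[d] (f '' A) := by
  rcases A.eq_empty_or_nonempty with rfl | ⟨a, ha⟩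
  · simp
  have : Nonempty S := ⟨a⟩
  have hL : LipschitzOnWith C (g ∘ Function.invFun f) (f '' A) := by
    rintro _ ⟨y, hy, rfl⟩ _ ⟨z, hz, rfl⟩
    simpa [Function.leftInverse_invFun hf _] using h y hy z hz
  have h2 := hL.hausdorffMeasure_image_le hd
  rwa [image_image, show (fun x => (g ∘ Function.invFun f) (f x)) = g from by
    ext x; simp [Function.leftInverse_invFun hf _]] at h2

/-- Locally, the Hausdorff measure on a graph is comparable to the area density. -/
lemma exists_nhds_hausdorffMeasure_graph_comparable (ι : E →ₗᵢ[ℝ] X) {e : X} (he : ‖e‖ = 1)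
    (hι : ∀ y, ⟪ι y, e⟫ = 0) {w : E → ℝ} (hw : ContDiff ℝ 1 w) {c : ℝ≥0} (hc : 1 < c) (y₀ : E) :
    ∃ U ∈ 𝓝 y₀, ∀ A ⊆ U, MeasurableSet A →
      μH[finrank ℝ E] (graphMap ι e w '' A) ≤
        (c : ℝ≥0∞) ^ (finrank ℝ E + 1) *
          ∫⁻ y in A, ENNReal.ofReal √(1 + ‖gradient w y‖ ^ 2) ∂μH[finrank ℝ E] ∧
      ∫⁻ y in A, ENNReal.ofReal √(1 + ‖gradient w y‖ ^ 2) ∂μH[finrank ℝ E] ≤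
        (c : ℝ≥0∞) ^ (finrank ℝ E + 1) * μH[finrank ℝ E] (graphMap ι e w '' A) := by
  set g := gradient w y₀ with hg
  set L := graphLin ι e g with hL
  have hstrict : HasStrictFDerivAt (graphMap ι e w) L y₀ := by
    have h1 : HasStrictFDerivAt w (innerSL ℝ g) y₀ := by
      rw [show innerSL ℝ g = fderiv ℝ w y₀ from toDual_gradient]
      exact hw.contDiffAt.hasStrictFDerivAt one_ne_zero
    exact ι.toContinuousLinearMap.hasStrictFDerivAt.add (h1.smul_const e)
  have hη : (0 : ℝ) < c - 1 := by simpa using hc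
  obtain ⟨U₁, hU₁, hU₁'⟩ := (hstrict.isLittleO.def hη).exists_mem
  rw [nhds_prod_eq, mem_prod_self_iff] at hU₁
  obtain ⟨V, hV, hVU⟩ := hU₁
  have hgc : Continuous (gradient w) := by
    have := hw.continuous_fderiv one_ne_zero
    exact (InnerProductSpace.toDual ℝ E).symm.continuous.comp this
  set W : E → ℝ := fun y => √(1 + ‖gradient w y‖ ^ 2) with hW
  have hWc : Continuous W := by fun_prop
  have hWpos : ∀ y, 0 < W y := fun y => by positivity
  have hc' : (1 : ℝ) < c := by exact_mod_cast hc
  have hU₂ : ∀ᶠ y in 𝓝 y₀, W y < c * W y₀ ∧ W y₀ < c * W y :=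
    (hWc.continuousAt.eventually_lt continuousAt_const
      (by nlinarith [hWpos y₀])).and
    (continuousAt_const.eventually_lt (hWc.continuousAt.const_mul _)
      (by nlinarith [hWpos y₀]))
  refine ⟨V ∩ {y | W y < c * W y₀ ∧ W y₀ < c * W y}, inter_mem hV hU₂, fun A hA hAm => ?_⟩
  have hclose : ∀ y ∈ A, ∀ z ∈ A,
      ‖graphMap ι e w y - graphMap ι e w z - L (y - z)‖ ≤ (c - 1) * ‖y - z‖ :=
    fun y hy z hz => hU₁' (y, z) (hVU ⟨(hA hy).1, (hA hz).1⟩)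
  have hLinj : Function.Injective L := by
    refine (injective_iff_map_eq_zero L).2 fun y hy => ?_
    have := norm_le_norm_graphLin ι he hι g y
    rw [← hL, hy, norm_zero] at this
    exact norm_eq_zero.1 (le_antisymm this (norm_nonneg _))
  have hLA : μH[finrank ℝ E] (L '' A) = ENNReal.ofReal (W y₀) * μH[finrank ℝ E] A := by
    have := LinearMap.hausdorffMeasure_image L.toLinearMap A
    rwa [normDet_graphLin ι he hι] at this
  have hd : (0 : ℝ) ≤ finrank ℝ E := by positivity
  have h1 : μH[finrank ℝ E] (graphMap ι e w '' A) ≤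
      (c : ℝ≥0∞) ^ (finrank ℝ E : ℝ) * μH[finrank ℝ E] (L '' A) := by
    refine hausdorffMeasure_image_le_of_dist_le hd hLinj fun y hy z hz => ?_
    rw [edist_nndist, edist_nndist]
    norm_cast
    rw [← NNReal.coe_le_coe, NNReal.coe_mul, coe_nndist, coe_nndist, dist_eq_norm, dist_eq_norm,
      ← map_sub]
    have a1 := hclose y hy z hz
    have a2 := norm_le_norm_graphLin ι he hι g (y - z)
    have a3 := norm_sub_norm_le (graphMap ι e w y - graphMap ι e w z) (L (y - z))
    rw [← hL] at a2
    nlinarith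
  have h2 : μH[finrank ℝ E] (L '' A) ≤
      (c : ℝ≥0∞) ^ (finrank ℝ E : ℝ) * μH[finrank ℝ E] (graphMap ι e w '' A) := by
    refine hausdorffMeasure_image_le_of_dist_le hd (graphMap_injective ι he hι w)
      fun y hy z hz => ?_
    rw [edist_nndist, edist_nndist]
    norm_cast
    rw [← NNReal.coe_le_coe, NNReal.coe_mul, coe_nndist, coe_nndist, dist_eq_norm, dist_eq_norm,
      ← map_sub]
    have a1 := hclose y hy z hz
    have a2 := norm_sub_le_norm_graphMap_sub ι he hι w y z
    have a3 := norm_sub_norm_le (L (y - z)) (graphMap ι e w y - graphMap ι e w z)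
    rw [norm_sub_rev (L (y - z))] at a3
    nlinarith
  rw [ENNReal.rpow_natCast] at h1 h2
  have h3 : ENNReal.ofReal (W y₀) * μH[finrank ℝ E] A ≤
      c * ∫⁻ y in A, ENNReal.ofReal (W y) ∂μH[finrank ℝ E] := by
    rw [← lintegral_const_mul _ (by fun_prop), ← setLIntegral_const]
    refine setLIntegral_mono (by fun_prop) fun y hy => ?_
    rw [← ENNReal.ofReal_coe_nnreal, ← ENNReal.ofReal_mul (by positivity)]
    exact ENNReal.ofReal_le_ofReal (hA hy).2.2.le
  have h4 : ∫⁻ y in A, ENNReal.ofReal (W y) ∂μH[finrank ℝ E] ≤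
      c * (ENNReal.ofReal (W y₀) * μH[finrank ℝ E] A) := by
    rw [← setLIntegral_const, ← lintegral_const_mul _ (by fun_prop)]
    refine setLIntegral_mono (by fun_prop) fun y hy => ?_
    rw [← ENNReal.ofReal_coe_nnreal, ← ENNReal.ofReal_mul (by positivity)]
    exact ENNReal.ofReal_le_ofReal (hA hy).2.1.le
  rw [hLA] at h1 h2
  constructor
  · calc _ ≤ _ := h1
      _ ≤ _ := mul_le_mul_right h3 _
      _ = _ := by rw [pow_succ, mul_assoc]
  · calc _ ≤ _ := h4
      _ ≤ _ := mul_le_mul_right h2 _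
      _ = _ := by rw [pow_succ', mul_assoc]

/-- A local comparison of measures is global. -/
lemma measure_le_smul_of_locally {Y : Type*} [TopologicalSpace Y] [SecondCountableTopology Y]
    [MeasurableSpace Y] [OpensMeasurableSpace Y] {μ ν : Measure Y} {c : ℝ≥0∞}
    (h : ∀ y, ∃ U ∈ 𝓝 y, ∀ A ⊆ U, MeasurableSet A → μ A ≤ c * ν A) : μ ≤ c • ν := by
  choose U hU hUA using h
  obtain ⟨s, hs, hcov⟩ := TopologicalSpace.countable_cover_nhds fun y => interior_mem_nhds.2 (hU y)
  rw [Measure.le_iff]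
  intro A hA
  have := hs.to_subtype
  rcases isEmpty_or_nonempty Y with hY | hY
  · simp [Set.eq_empty_of_isEmpty A]
  have hsne : s.Nonempty := by
    rw [nonempty_iff_ne_empty]
    rintro rfl
    simp only [mem_empty_iff_false, iUnion_of_empty, iUnion_empty] at hcov
    exact empty_ne_univ hcov
  obtain ⟨f, hf⟩ := hs.exists_eq_range hsne
  set D : ℕ → Set Y := disjointed (fun i => interior (U (f i)))
  have hDm : ∀ k, MeasurableSet (D k) :=
    MeasurableSet.disjointed fun i => isOpen_interior.measurableSet
  have hDA : A = ⋃ k, A ∩ D k := by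
    rw [← inter_iUnion, iUnion_disjointed]
    rw [hf, biUnion_range] at hcov
    rw [hcov, inter_univ]
  have hdisj : Pairwise (Function.onFun Disjoint fun k => A ∩ D k) := fun i j hij =>
    (disjoint_disjointed _ hij).mono inter_subset_right inter_subset_right
  have hsum : ∀ ρ : Measure Y, ρ A = ∑' k, ρ (A ∩ D k) := fun ρ => by
    conv_lhs => rw [hDA]
    exact measure_iUnion hdisj fun k => hA.inter (hDm k)
  rw [Measure.smul_apply, smul_eq_mul, hsum μ, hsum ν, ← ENNReal.tsum_mul_left]
  exact ENNReal.tsum_le_tsum fun k => hUA (f k) _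
    (inter_subset_right.trans ((disjointed_subset _ _).trans interior_subset)) (hA.inter (hDm k))

lemma continuous_graphMap (ι : E →ₗᵢ[ℝ] X) (e : X) {w : E → ℝ} (hw : Continuous w) :
    Continuous (graphMap ι e w) :=
  ι.continuous.add (hw.smul continuous_const)

lemma measurableEmbedding_graphMap (ι : E →ₗᵢ[ℝ] X) {e : X} (he : ‖e‖ = 1)
    (hι : ∀ y, ⟪ι y, e⟫ = 0) {w : E → ℝ} (hw : Continuous w) :
    MeasurableEmbedding (graphMap ι e w) :=
  (continuous_graphMap ι e hw).measurableEmbedding (graphMap_injective ι he hι w)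

/-- The **area formula** for graphs. -/
theorem comap_graphMap_hausdorffMeasure (ι : E →ₗᵢ[ℝ] X) {e : X} (he : ‖e‖ = 1)
    (hι : ∀ y, ⟪ι y, e⟫ = 0) {w : E → ℝ} (hw : ContDiff ℝ 1 w) :
    (μH[finrank ℝ E] : Measure X).comap (graphMap ι e w) =
      (μH[finrank ℝ E] : Measure E).withDensity
        fun y => ENNReal.ofReal √(1 + ‖gradient w y‖ ^ 2) := by
  set ν := (μH[finrank ℝ E] : Measure X).comap (graphMap ι e w)
  set ρ := (μH[finrank ℝ E] : Measure E).withDensity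
        fun y => ENNReal.ofReal √(1 + ‖gradient w y‖ ^ 2)
  have hemb := measurableEmbedding_graphMap ι he hι hw.continuous
  have hν : ∀ A, ν A = μH[finrank ℝ E] (graphMap ι e w '' A) := fun A => hemb.comap_apply _ A
  have key : ∀ c : ℝ≥0, 1 < c → ν ≤ ((c : ℝ≥0∞) ^ (finrank ℝ E + 1)) • ρ ∧
      ρ ≤ ((c : ℝ≥0∞) ^ (finrank ℝ E + 1)) • ν := by
    intro c hc
    constructor
    all_goals
      refine measure_le_smul_of_locally fun y => ?_
      obtain ⟨U, hU, hUA⟩ := exists_nhds_hausdorffMeasure_graph_comparable ι he hι hw hc y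
      refine ⟨U, hU, fun A hA hAm => ?_⟩
      rw [hν, withDensity_apply _ hAm]
    · exact (hUA A hA hAm).1
    · exact (hUA A hA hAm).2
  have lim : ∀ a b : ℝ≥0∞,
      (∀ c : ℝ≥0, 1 < c → a ≤ (c : ℝ≥0∞) ^ (finrank ℝ E + 1) * b) → a ≤ b := by
    intro a b h
    have hc : ContinuousAt (fun c : ℝ≥0 => (c : ℝ≥0∞) ^ (finrank ℝ E + 1)) 1 := by
      have : Continuous fun c : ℝ≥0 => ((c ^ (finrank ℝ E + 1) : ℝ≥0) : ℝ≥0∞) := by fun_prop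
      simpa using this.continuousAt (x := 1)
    have ht : Tendsto (fun c : ℝ≥0 => (c : ℝ≥0∞) ^ (finrank ℝ E + 1) * b) (𝓝[>] 1)
        (𝓝 (1 * b)) := by
      refine ENNReal.Tendsto.mul_const ?_ (Or.inl one_ne_zero)
      simpa using hc.tendsto.mono_left nhdsWithin_le_nhds
    rw [one_mul] at ht
    exact ge_of_tendsto ht (eventually_mem_nhdsWithin.mono h)
  refine le_antisymm (Measure.le_iff'.2 fun A => lim _ _ fun c hc => (key c hc).1 A)
    (Measure.le_iff'.2 fun A => lim _ _ fun c hc => (key c hc).2 A)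

/-- Change of variables for integrals over graphs. -/
theorem setIntegral_graphMap (ι : E →ₗᵢ[ℝ] X) {e : X} (he : ‖e‖ = 1)
    (hι : ∀ y, ⟪ι y, e⟫ = 0) {w : E → ℝ} (hw : ContDiff ℝ 1 w) {B : Set E} (hB : MeasurableSet B)
    (h : X → ℝ) :
    ∫ x in graphMap ι e w '' B, h x ∂μH[finrank ℝ E] =
      ∫ y in B, √(1 + ‖gradient w y‖ ^ 2) * h (graphMap ι e w y) ∂μH[finrank ℝ E] := by
  have hemb := measurableEmbedding_graphMap ι he hι hw.continuous
  have hgc : Continuous (gradient w) :=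
    (InnerProductSpace.toDual ℝ E).symm.continuous.comp (hw.continuous_fderiv one_ne_zero)
  have h1 : (μH[finrank ℝ E] : Measure X).restrict (graphMap ι e w '' B) =
      (((μH[finrank ℝ E] : Measure X).comap (graphMap ι e w)).restrict B).map
        (graphMap ι e w) := by
    rw [← hemb.injective.preimage_image B, ← hemb.restrict_map, hemb.map_comap,
      hemb.injective.preimage_image B,
      Measure.restrict_restrict (hemb.measurableSet_image.2 hB),
      inter_eq_left.2 (image_subset_range _ _)]
  rw [h1, hemb.integral_map, comap_graphMap_hausdorffMeasure ι he hι hw,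
    setIntegral_withDensity_eq_setIntegral_toReal_smul (by fun_prop) (by simp) _ hB]
  refine setIntegral_congr_fun hB fun y _ => ?_
  simp [ENNReal.toReal_ofReal (Real.sqrt_nonneg _)]

end GraphArea

section LevelSet

variable {X : Type*} [NormedAddCommGroup X] [InnerProductSpace ℝ X] [FiniteDimensional ℝ X]
  [MeasurableSpace X] [BorelSpace X]

/-- Regular level sets have locally finite hypersurface measure. -/
lemma exists_nhds_hausdorffMeasure_levelSet_lt_top {F : X → ℝ} {x : X} (hF : ContDiffAt ℝ 1 F x)
    (hx : fderiv ℝ F x ≠ 0) :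
    ∃ U ∈ 𝓝 x, μH[(finrank ℝ X : ℝ) - 1] (U ∩ {z | F z = F x}) < ⊤ := by
  have hf : HasStrictFDerivAt F (fderiv ℝ F x) x := hF.hasStrictFDerivAt one_ne_zero
  set f' := fderiv ℝ F x
  have hsurj : f'.range = ⊤ :=
    LinearMap.range_eq_top.2 (LinearMap.surjective (f := f'.toLinearMap) (by
      intro h; apply hx; ext v; exact DFunLike.congr_fun h v))
  set ψ := hf.implicitFunction F f' hsurj (F x)
  set H := hf.implicitToOpenPartialHomeomorph F f' hsurj
  obtain ⟨K, s, hs, hL⟩ := (hf.to_implicitFunction hsurj).exists_lipschitzOnWith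
  have hrank : (finrank ℝ f'.ker : ℝ) = finrank ℝ X - 1 := by
    have := LinearMap.finrank_range_add_finrank_ker f'.toLinearMap
    have h2 : finrank ℝ f'.toLinearMap.range = 1 := by
      rw [show f'.toLinearMap.range = ⊤ from hsurj]; simp
    rw [h2] at this
    have h3 : (1 : ℝ) + finrank ℝ f'.toLinearMap.ker = finrank ℝ X := by exact_mod_cast this
    rw [← h3]
    simp
  have hcont : Tendsto (fun z => (H z).2) (𝓝 x) (𝓝 0) := by
    have h1 : ContinuousAt H x :=
      H.continuousAt (hf.mem_implicitToOpenPartialHomeomorph_source hsurj)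
    have h2 : Tendsto (fun z => (H z).2) (𝓝 x) (𝓝 (H x).2) := h1.snd
    rwa [hf.implicitToOpenPartialHomeomorph_self hsurj] at h2
  have hT : s ∩ closedBall 0 1 ∈ 𝓝 (0 : f'.ker) :=
    inter_mem hs (closedBall_mem_nhds _ one_pos)
  refine ⟨_, inter_mem (hf.eq_implicitFunction hsurj) (hcont hT), ?_⟩
  rw [← hrank]
  calc _ ≤ μH[finrank ℝ f'.ker] (ψ '' (s ∩ closedBall 0 1)) := by
        refine measure_mono ?_
        rintro z ⟨⟨hz1, hz2⟩, hz3⟩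
        refine ⟨_, hz2, ?_⟩
        have : hf.implicitFunction F f' hsurj (F z) (H z).2 = z := hz1
        rwa [show F z = F x from hz3] at this
    _ ≤ (K : ℝ≥0∞) ^ (finrank ℝ f'.ker : ℝ) * μH[finrank ℝ f'.ker] (s ∩ closedBall 0 1) :=
        (hL.mono inter_subset_left).hausdorffMeasure_image_le (by positivity)
    _ < ⊤ := by
        refine ENNReal.mul_lt_top (ENNReal.rpow_lt_top_of_nonneg (by positivity) ENNReal.coe_ne_top) ?_
        exact (measure_mono inter_subset_right).trans_lt (isCompact_closedBall _ _).measure_lt_top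

lemma SmoothBody.isClosed_bdry {n : ℕ} (K : SmoothBody n) : IsClosed K.bdry :=
  isClosed_eq K.smooth.continuous continuous_const

lemma SmoothBody.isCompact_bdry {n : ℕ} (K : SmoothBody n) : IsCompact K.bdry :=
  Metric.isCompact_of_isClosed_isBounded K.isClosed_bdry
    (K.bounded.subset fun _ hx => le_of_eq hx)

lemma SmoothBody.fderiv_ne_zero {n : ℕ} (K : SmoothBody n) {x : Euc n} (hx : x ∈ K.bdry) :
    fderiv ℝ K.F x ≠ 0 := fun h => K.regular x hx (by simp [gradient, h])

lemma SmoothBody.hausdorffMeasure_bdry_lt_top {n : ℕ} (K : SmoothBody n) :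
    μH[(n : ℝ) - 1] K.bdry < ⊤ := by
  refine K.isCompact_bdry.measure_lt_top_of_nhdsWithin fun x hx => ?_
  obtain ⟨U, hU, hfin⟩ := exists_nhds_hausdorffMeasure_levelSet_lt_top
    (K.smooth.contDiffAt.of_le (by simp)) (K.fderiv_ne_zero hx)
  refine ⟨U ∩ {z | K.F z = K.F x}, ?_, by simpa using hfin⟩
  have : {z | K.F z = K.F x} = K.bdry := by rw [show K.F x = 0 from hx]; rfl
  rw [this]
  exact inter_mem (mem_nhdsWithin_of_mem_nhds hU) self_mem_nhdsWithin

lemma contDiff_gradient {E : Type*} [NormedAddCommGroup E] [InnerProductSpace ℝ E]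
    [CompleteSpace E] {f : E → ℝ} (hf : ContDiff ℝ ∞ f) : ContDiff ℝ ∞ (gradient f) :=
  (InnerProductSpace.toDual ℝ E).symm.contDiff.comp (hf.fderiv_right (m := ∞) (by simp))

lemma SmoothBody.contDiffAt_normal {n : ℕ} (K : SmoothBody n) {x : Euc n} (hx : x ∈ K.bdry) :
    ContDiffAt ℝ ∞ K.normal x := by
  have h1 : ContDiffAt ℝ ∞ (gradient K.F) x := (contDiff_gradient K.smooth).contDiffAt
  exact ((h1.norm ℝ (K.regular x hx)).inv (norm_ne_zero_iff.2 (K.regular x hx))).smul h1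

lemma SmoothBody.continuousOn_meanCurv {n : ℕ} (K : SmoothBody n) :
    ContinuousOn K.meanCurv K.bdry := by
  intro x hx
  have h : ContinuousAt (fderiv ℝ K.normal) x :=
    ((K.contDiffAt_normal hx).fderiv_right (m := 0) (by simp)).continuousAt
  have h2 : Continuous fun A : Euc n →L[ℝ] Euc n => LinearMap.trace ℝ (Euc n) A.toLinearMap :=
    (LinearMap.continuous_of_finiteDimensional
      (LinearMap.trace ℝ (Euc n) ∘ₗ ContinuousLinearMap.coeLM ℝ))
  exact (h2.continuousAt.comp h).continuousWithinAt

lemma SmoothBody.integrableOn_meanCurv {n : ℕ} (K : SmoothBody n) :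
    IntegrableOn K.meanCurv K.bdry μH[(n : ℝ) - 1] := by
  obtain ⟨C, hC⟩ := K.isCompact_bdry.exists_bound_of_continuousOn K.continuousOn_meanCurv
  exact ⟨K.continuousOn_meanCurv.aestronglyMeasurable K.isClosed_bdry.measurableSet,
    .restrict_of_bounded C K.hausdorffMeasure_bdry_lt_top
      ((ae_restrict_iff' K.isClosed_bdry.measurableSet).2 (ae_of_all _ hC))⟩

end LevelSet

section MeanCurvature

set_option linter.unusedSectionVars false

variable {E X : Type*} [NormedAddCommGroup E] [InnerProductSpace ℝ E] [FiniteDimensional ℝ E]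
  [NormedAddCommGroup X] [InnerProductSpace ℝ X] [FiniteDimensional ℝ X]

lemma gradient_eq_of_hasFDerivAt {f : E → ℝ} {L : E →L[ℝ] ℝ} {x g : E} (h : HasFDerivAt f L x)
    (hg : ∀ v, ⟪g, v⟫ = L v) : gradient f x = g := by
  refine HasGradientAt.gradient (hasGradientAt_iff_hasFDerivAt.2 ?_)
  have : InnerProductSpace.toDual ℝ E g = L := ContinuousLinearMap.ext hg
  rwa [this]

/-- The trace of the derivative of a normalized vector field. -/
lemma trace_fderiv_normalize {G : X → X} {A : X →L[ℝ] X} {x : X} (hG : HasFDerivAt G A x)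
    (h0 : G x ≠ 0) :
    LinearMap.trace ℝ X (fderiv ℝ (fun z => ‖G z‖⁻¹ • G z) x).toLinearMap =
      ‖G x‖⁻¹ * (LinearMap.trace ℝ X A.toLinearMap - ⟪A (G x), G x⟫ / ‖G x‖ ^ 2) := by
  have hn : 0 < ‖G x‖ := norm_pos_iff.2 h0
  have h1 : HasFDerivAt (fun z => ‖G z‖) (‖G x‖⁻¹ • (innerSL ℝ (G x)).comp A) x := by
    have h2 : HasFDerivAt (fun z => √(‖G z‖ ^ 2)) _ x := hG.norm_sq.sqrt (by positivity)
    simp only [Real.sqrt_sq (norm_nonneg _)] at h2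
    convert h2 using 1
    ext v
    simp
    field_simp
  have h3 := ((hasDerivAt_inv hn.ne').comp_hasFDerivAt x h1).smul hG
  have h4 : HasFDerivAt (fun z => ‖G z‖⁻¹ • G z) _ x := h3
  rw [h4.fderiv]
  simp only [ContinuousLinearMap.toLinearMap_add, ContinuousLinearMap.toLinearMap_smul, map_add,
    map_smul, ContinuousLinearMap.coe_smulRight]
  rw [LinearMap.trace_smulRight]
  simp [real_inner_comm]
  field_simp
  ring

/-- An orthogonal splitting of `X` into an isometric copy of `E` and a line. -/
structure Splitting (E X : Type*) [NormedAddCommGroup E] [InnerProductSpace ℝ E]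
    [NormedAddCommGroup X] [InnerProductSpace ℝ X] where
  /-- The inclusion of the hyperplane. -/
  ι : E →ₗᵢ[ℝ] X
  /-- The unit vector spanning the line. -/
  e : X
  norm_e : ‖e‖ = 1
  inner_ι_e : ∀ y, ⟪ι y, e⟫ = 0
  exists_decomp : ∀ x, ∃ (y : E) (t : ℝ), x = ι y + t • e

namespace Splitting

variable (S : Splitting E X)

/-- The orthogonal projection to the hyperplane. -/
def proj : X →L[ℝ] E := ContinuousLinearMap.adjoint S.ι.toContinuousLinearMap

/-- The coordinate along the line. -/
def height : X →L[ℝ] ℝ := innerSL ℝ S.e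

lemma inner_e_ι (y : E) : ⟪S.e, S.ι y⟫ = 0 := by rw [real_inner_comm]; exact S.inner_ι_e y

lemma inner_ι_left (y : E) (x : X) : ⟪S.ι y, x⟫ = ⟪y, S.proj x⟫ :=
  (ContinuousLinearMap.adjoint_inner_right S.ι.toContinuousLinearMap y x).symm

@[simp] lemma proj_ι (y : E) : S.proj (S.ι y) = y :=
  ext_inner_left ℝ fun z => by rw [← inner_ι_left, LinearIsometry.inner_map_map]

@[simp] lemma proj_e : S.proj S.e = 0 :=
  ext_inner_left ℝ fun z => by rw [← inner_ι_left, inner_ι_e, inner_zero_right]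

@[simp] lemma height_ι (y : E) : S.height (S.ι y) = 0 := S.inner_e_ι y

@[simp] lemma height_e : S.height S.e = 1 := by
  simp [height, innerSL_apply_apply, S.norm_e]

lemma decomp (x : X) : S.ι (S.proj x) + S.height x • S.e = x := by
  obtain ⟨y, t, rfl⟩ := S.exists_decomp x
  simp

lemma inner_eq (x z : X) : ⟪x, z⟫ = ⟪S.proj x, S.proj z⟫ + S.height x * S.height z := by
  conv_lhs => rw [← S.decomp x]
  rw [inner_add_left, inner_ι_left, inner_smul_left]
  rfl

lemma norm_sq_eq (x : X) : ‖x‖ ^ 2 = ‖S.proj x‖ ^ 2 + S.height x ^ 2 := by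
  rw [← real_inner_self_eq_norm_sq, S.inner_eq, real_inner_self_eq_norm_sq, sq (S.height x)]

/-- The defining function `t² - u(y)` in the coordinates `(y, t)` of the splitting. -/
def defFun (u : E → ℝ) (x : X) : ℝ := S.height x ^ 2 - u (S.proj x)

lemma contDiff_defFun {u : E → ℝ} (hu : ContDiff ℝ ∞ u) : ContDiff ℝ ∞ (S.defFun u) :=
  (S.height.contDiff.pow 2).sub (hu.comp S.proj.contDiff)

lemma gradient_defFun {u : E → ℝ} (hu : ContDiff ℝ ∞ u) (x : X) :
    gradient (S.defFun u) x = (2 * S.height x) • S.e - S.ι (gradient u (S.proj x)) := by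
  have h1 : HasFDerivAt u (fderiv ℝ u (S.proj x)) (S.proj x) :=
    (hu.differentiable (by simp) _).hasFDerivAt
  have h : HasFDerivAt (S.defFun u) ((2 * S.height x) • S.height - (fderiv ℝ u (S.proj x)).comp S.proj) x := by
    have := (S.height.hasFDerivAt (x := x)).pow 2
    simp only [Nat.add_one_sub_one, pow_one, nsmul_eq_mul, Nat.cast_ofNat] at this
    exact this.sub (h1.comp x S.proj.hasFDerivAt)
  refine gradient_eq_of_hasFDerivAt h fun v => ?_
  simp [inner_sub_left, inner_smul_left, inner_ι_left, inner_gradient_left, height]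

lemma hasFDerivAt_gradient_defFun {u : E → ℝ} (hu : ContDiff ℝ ∞ u) (x : X) :
    HasFDerivAt (gradient (S.defFun u)) ((2 : ℝ) • S.height.smulRight S.e -
      S.ι.toContinuousLinearMap.comp ((fderiv ℝ (gradient u) (S.proj x)).comp S.proj)) x := by
  have h1 : HasFDerivAt (gradient u) (fderiv ℝ (gradient u) (S.proj x)) (S.proj x) :=
    ((contDiff_gradient hu).differentiable (by simp) _).hasFDerivAt
  have h2 : HasFDerivAt (fun x => (2 * S.height x) • S.e - S.ι (gradient u (S.proj x))) ((2 : ℝ) •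
      S.height.smulRight S.e - S.ι.toContinuousLinearMap.comp
        ((fderiv ℝ (gradient u) (S.proj x)).comp S.proj)) x := by
    refine HasFDerivAt.sub ?_ (S.ι.toContinuousLinearMap.hasFDerivAt.comp x
      (h1.comp x S.proj.hasFDerivAt))
    convert ((S.height.hasFDerivAt (x := x)).const_mul 2).smul_const S.e using 1
    ext v
    simp [mul_smul]
  rwa [funext (S.gradient_defFun hu)]

/-- Mean curvature of the level set `{t² = u(y)}` where `u = w²`, weighted by the area density of
the graph of `w`. -/
lemma sqrt_mul_trace_fderiv_normal {u w : E → ℝ} (hu : ContDiff ℝ ∞ u) (hw : ContDiff ℝ ∞ w)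
    {y : E} (huw : u =ᶠ[𝓝 y] fun z => w z ^ 2) (hpos : 0 < w y) {σ : ℝ} (hσ : σ ^ 2 = 1) :
    √(1 + ‖gradient w y‖ ^ 2) * LinearMap.trace ℝ X (fderiv ℝ (fun z =>
        ‖gradient (S.defFun u) z‖⁻¹ • gradient (S.defFun u) z) (S.ι y + (σ * w y) • S.e)).toLinearMap
      = ⟪fderiv ℝ (gradient w) y (gradient w y), gradient w y⟫ / (1 + ‖gradient w y‖ ^ 2) -
        LinearMap.trace ℝ E (fderiv ℝ (gradient w) y).toLinearMap := by
  set g := gradient w y with hg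
  set A := fderiv ℝ (gradient w) y with hA
  set x := S.ι y + (σ * w y) • S.e with hx
  have hproj : S.proj x = y := by simp [hx]
  have hheight : S.height x = σ * w y := by simp [hx]
  have hgradu : gradient u =ᶠ[𝓝 y] fun z => (2 * w z) • gradient w z := by
    refine (huw.gradient).trans (Eventually.of_forall fun z => ?_)
    have h1 : HasFDerivAt w (fderiv ℝ w z) z := (hw.differentiable (by simp) _).hasFDerivAt
    refine gradient_eq_of_hasFDerivAt (h1.pow 2) fun v => ?_
    simp [inner_smul_left, inner_gradient_left]
  have hgu : gradient u y = (2 * w y) • g := hgradu.eq_of_nhds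
  have hB : fderiv ℝ (gradient u) y = (2 * w y) • A + (2 : ℝ) • (innerSL ℝ g).smulRight g := by
    rw [hgradu.fderiv_eq]
    have h1 : HasFDerivAt w (fderiv ℝ w y) y := (hw.differentiable (by simp) _).hasFDerivAt
    have h2 : HasFDerivAt (gradient w) A y :=
      ((contDiff_gradient hw).differentiable (by simp) _).hasFDerivAt
    refine ((h1.const_mul 2).smul h2).fderiv.trans ?_
    rw [show fderiv ℝ w y = innerSL ℝ g from (toDual_gradient (𝕜 := ℝ)).symm]
    ext v
    simp [mul_smul, hg]
  have hGx : gradient (S.defFun u) x = (2 * w y) • (σ • S.e - S.ι g) := by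
    rw [S.gradient_defFun hu, hproj, hheight, hgu, map_smul, smul_sub, smul_smul]
    ring_nf
  have hnormsq : ‖σ • S.e - S.ι g‖ ^ 2 = 1 + ‖g‖ ^ 2 := by
    rw [S.norm_sq_eq]
    simp [hσ]
    ring
  set W := √(1 + ‖g‖ ^ 2) with hW
  have hW2 : W ^ 2 = 1 + ‖g‖ ^ 2 := Real.sq_sqrt (by positivity)
  have hWpos : 0 < W := Real.sqrt_pos.2 (by positivity)
  have hnorm : ‖gradient (S.defFun u) x‖ = 2 * w y * W := by
    rw [hGx, norm_smul, Real.norm_of_nonneg (by positivity), hW, ← hnormsq,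
      Real.sqrt_sq (norm_nonneg _)]
  rw [trace_fderiv_normalize (S.hasFDerivAt_gradient_defFun hu x)
    (norm_pos_iff.1 (by rw [hnorm]; positivity)), hnorm, hGx, hproj, hB]
  have htr : LinearMap.trace ℝ X ((2 : ℝ) • S.height.smulRight S.e -
      S.ι.toContinuousLinearMap.comp (((2 * w y) • A +
        (2 : ℝ) • (innerSL ℝ g).smulRight g).comp S.proj)).toLinearMap =
      2 - 2 * w y * LinearMap.trace ℝ E A.toLinearMap - 2 * ‖g‖ ^ 2 := by
    rw [ContinuousLinearMap.toLinearMap_sub, map_sub, ContinuousLinearMap.toLinearMap_comp,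
      LinearMap.trace_comp_comm']
    have : (((2 * w y) • A + (2 : ℝ) • (innerSL ℝ g).smulRight g).comp S.proj).toLinearMap ∘ₗ
        S.ι.toContinuousLinearMap.toLinearMap =
        (2 * w y) • A.toLinearMap + (2 : ℝ) • (innerSL ℝ g).toLinearMap.smulRight g := by
      ext v
      simp
    rw [this, ContinuousLinearMap.toLinearMap_smul, ContinuousLinearMap.coe_smulRight, map_smul,
      LinearMap.trace_smulRight, map_add, map_smul, map_smul, LinearMap.trace_smulRight]
    simp
    ring
  have hinner : ⟪((2 : ℝ) • S.height.smulRight S.e -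
      S.ι.toContinuousLinearMap.comp (((2 * w y) • A +
        (2 : ℝ) • (innerSL ℝ g).smulRight g).comp S.proj)) ((2 * w y) • (σ • S.e - S.ι g)),
        (2 * w y) • (σ • S.e - S.ι g)⟫ =
      (2 * w y) ^ 2 * (2 - 2 * w y * ⟪A g, g⟫ - 2 * ‖g‖ ^ 4) := by
    rw [map_smul, inner_smul_left, inner_smul_right, S.inner_eq]
    simp [inner_add_left, inner_smul_left]
    linear_combination (4 * w y ^ 2 * 2) * hσ
  rw [htr, hinner]
  have : ‖g‖ ^ 2 = W ^ 2 - 1 := by rw [hW2]; ring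
  rw [← hW2, show ‖g‖ ^ 4 = (‖g‖ ^ 2) ^ 2 by ring, this]
  field_simp
  ring

end Splitting

end MeanCurvature

lemma Real.arctan_lt_self {x : ℝ} (hx : 0 < x) : arctan x < x := by
  simpa using lt_tan (arctan_pos.2 hx) (arctan_lt_pi_div_two x)

/-- The one-dimensional computation giving the sign of the integral of a radial bump. -/
lemma integral_pow_mul_deriv_neg {p : ℝ → ℝ} (hp : ContDiff ℝ 1 p) (d : ℕ)
    (hnonneg : ∀ r, 0 ≤ r → 0 ≤ p r) (hzero : ∀ r, 1 ≤ r → p r = 0) (h0 : p 0 = 0)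
    (hpos : ∃ r, 0 < r ∧ 0 < p r) :
    ∫ r in Ioi (0 : ℝ), r ^ (d + 1) * (p r ^ 2 * deriv p r / (1 + p r ^ 2)) < 0 := by
  set D : ℝ → ℝ := fun r => r ^ (d + 1) * (p r ^ 2 * deriv p r / (1 + p r ^ 2))
  set G : ℝ → ℝ := fun r => (d + 1) * r ^ d * (p r - arctan (p r))
  have hpc : Continuous p := hp.continuous
  have hpc' : Continuous (deriv p) := hp.continuous_deriv le_rfl
  have hDc : Continuous D := by
    refine (continuous_id.pow _).mul (((hpc.pow 2).mul hpc').div (by fun_prop) fun r => ?_)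
    positivity
  have hGc : Continuous G := by
    have := continuous_arctan.comp hpc
    fun_prop
  have hinterval : ∫ r in Ioi (0 : ℝ), D r = ∫ r in (0 : ℝ)..1, D r := by
    rw [intervalIntegral.integral_of_le zero_le_one]
    refine (setIntegral_eq_of_subset_of_forall_sdiff_eq_zero measurableSet_Ioi
      Ioc_subset_Ioi_self fun r hr => ?_)
    have : 1 ≤ r := by
      by_contra! h
      exact hr.2 ⟨hr.1, h.le⟩
    simp [D, hzero r this]
  have hderiv : ∀ r ∈ uIcc (0 : ℝ) 1,
      HasDerivAt (fun r => r ^ (d + 1) * (p r - arctan (p r))) (G r + D r) r := by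
    intro r _
    have h1 : HasDerivAt p (deriv p r) r := (hp.differentiable one_ne_zero r).hasDerivAt
    refine ((hasDerivAt_pow (d + 1) r).mul (h1.sub h1.arctan)).congr_deriv ?_
    have : 1 + p r ^ 2 ≠ 0 := by positivity
    simp only [G, D, Nat.cast_add, Nat.cast_one, Nat.add_sub_cancel, Pi.sub_apply]
    congr 1
    field_simp
    ring
  have hsum := intervalIntegral.integral_eq_sub_of_hasDerivAt hderiv
    ((hGc.add hDc).intervalIntegrable _ _)
  rw [intervalIntegral.integral_add (hGc.intervalIntegrable _ _) (hDc.intervalIntegrable _ _),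
    h0, hzero 1 le_rfl] at hsum
  have hG : 0 < ∫ r in (0 : ℝ)..1, G r := by
    obtain ⟨r, hr, hpr⟩ := hpos
    refine intervalIntegral.integral_pos zero_lt_one hGc.continuousOn (fun s hs => ?_)
      ⟨r, ⟨hr.le, ?_⟩, ?_⟩
    · have : 0 ≤ p s - arctan (p s) := by
        rcases (hnonneg s hs.1.le).eq_or_lt with h | h
        · simp [← h]
        · exact sub_nonneg.2 (arctan_lt_self h).le
      have := hs.1.le
      positivity
    · by_contra! h
      exact hpr.ne' (hzero r h.le)
    · have := sub_pos.2 (arctan_lt_self hpr)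
      positivity
  rw [hinterval]
  simp only [arctan_zero, sub_self, mul_zero] at hsum
  linarith

section Density

variable {E : Type*} [NormedAddCommGroup E] [InnerProductSpace ℝ E] [FiniteDimensional ℝ E]

set_option linter.unusedSectionVars false

/-- The density `⟨∇²f ∇f, ∇f⟩ / (1 + |∇f|²)`. -/
def curvDensity (f : E → ℝ) (y : E) : ℝ :=
  ⟪fderiv ℝ (gradient f) y (gradient f y), gradient f y⟫ / (1 + ‖gradient f y‖ ^ 2)

lemma hasFDerivAt_radial {Φ : ℝ → ℝ} {k : ℝ} {y : E} (h : HasDerivAt Φ k (‖y‖ ^ 2)) :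
    HasFDerivAt (fun z : E => Φ (‖z‖ ^ 2)) ((2 * k) • innerSL ℝ y) y := by
  have h1 : HasFDerivAt (fun z : E => ‖z‖ ^ 2) ((2 : ℝ) • innerSL ℝ y) y := by
    simpa [← Nat.cast_smul_eq_nsmul ℝ] using (hasStrictFDerivAt_norm_sq y).hasFDerivAt
  have := h.comp_hasFDerivAt y h1
  rwa [smul_smul, mul_comm] at this

lemma gradient_radial {Φ : ℝ → ℝ} {k : ℝ} {y : E} (h : HasDerivAt Φ (k / 2) (‖y‖ ^ 2)) :
    gradient (fun z : E => Φ (‖z‖ ^ 2)) y = k • y := by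
  refine gradient_eq_of_hasFDerivAt (hasFDerivAt_radial h) fun v => ?_
  simp [inner_smul_left, mul_div_cancel₀]

lemma curvDensity_radial {Φ k : ℝ → ℝ} (hk : ContDiff ℝ ∞ k)
    (h : ∀ s, HasDerivAt Φ (k s / 2) s) (y : E) :
    curvDensity (fun z : E => Φ (‖z‖ ^ 2)) y =
      (k (‖y‖ ^ 2) * ‖y‖) ^ 2 * deriv (fun r => k (r ^ 2) * r) ‖y‖ /
        (1 + (k (‖y‖ ^ 2) * ‖y‖) ^ 2) := by
  have hg : gradient (fun z : E => Φ (‖z‖ ^ 2)) = fun z => k (‖z‖ ^ 2) • z :=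
    funext fun z => gradient_radial (h _)
  have hk' : ∀ s, HasDerivAt k (deriv k s) s := fun s =>
    (hk.differentiable (by simp) s).hasDerivAt
  have h1 := (hasFDerivAt_radial (hk' (‖y‖ ^ 2))).smul (hasFDerivAt_id y)
  have h2 : deriv (fun r => k (r ^ 2) * r) ‖y‖ =
      k (‖y‖ ^ 2) + 2 * deriv k (‖y‖ ^ 2) * ‖y‖ ^ 2 := by
    have := ((hk' (‖y‖ ^ 2)).comp ‖y‖ (hasDerivAt_pow 2 ‖y‖)).mul (hasDerivAt_id ‖y‖)
    refine this.deriv.trans ?_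
    simp
    ring
  have h3 : fderiv ℝ (fun z : E => k (‖z‖ ^ 2) • z) y = _ := h1.fderiv
  rw [curvDensity, hg, h3, h2]
  simp only [norm_smul, mul_pow, Real.norm_eq_abs, sq_abs]
  congr 1
  simp [inner_add_left, inner_smul_left, inner_smul_right]
  ring

variable [MeasurableSpace E] [BorelSpace E] (μ : Measure E) [μ.IsAddHaarMeasure]

/-- A small bump whose curvature density has negative integral. -/
lemma exists_bump_curvDensity_neg (hE : 2 ≤ finrank ℝ E) {a : ℝ} (ha : 0 < a) :
    ∃ φ : E → ℝ, ContDiff ℝ ∞ φ ∧ tsupport φ ⊆ ball 0 (1 / 2) ∧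
      (∀ y, |φ y| ≤ a) ∧ (∀ y, ‖gradient φ y‖ ≤ a) ∧ ∫ y, curvDensity φ y ∂μ < 0 := by
  let b : ContDiffBump (1 / 8 : ℝ) := ⟨1 / 32, 1 / 16, by norm_num, by norm_num⟩
  set k : ℝ → ℝ := fun s => a * b s with hk_def
  have hk : ContDiff ℝ ∞ k := contDiff_const.mul b.contDiff
  have hk0 : ∀ s, 3 / 16 ≤ s → k s = 0 := fun s hs => by
    have : b s = 0 := b.zero_of_le_dist (by
      rw [Real.dist_eq, abs_of_nonneg (by linarith)]
      change (1 / 16 : ℝ) ≤ _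
      linarith)
    simp [hk_def, this]
  have hk_nonneg : ∀ s, 0 ≤ k s := fun s => mul_nonneg ha.le b.nonneg
  have hk_le : ∀ s, k s ≤ a := fun s => mul_le_of_le_one_right ha.le b.le_one
  set Φ : ℝ → ℝ := fun s => ∫ t in (3 / 16 : ℝ)..s, k t / 2 with hΦ_def
  have hkc : Continuous fun t => k t / 2 := hk.continuous.div_const 2
  have hΦ' : ∀ s, HasDerivAt Φ (k s / 2) s := fun s =>
    intervalIntegral.integral_hasDerivAt_right (hkc.intervalIntegrable _ _)
      hkc.stronglyMeasurable.stronglyMeasurableAtFilter hkc.continuousAt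
  have hΦ : ContDiff ℝ ∞ Φ := contDiff_infty_iff_deriv.2
    ⟨fun s => (hΦ' s).differentiableAt, by
      rw [funext fun s => (hΦ' s).deriv]
      exact hk.div_const 2⟩
  have hΦ0 : ∀ s, 3 / 16 ≤ s → Φ s = 0 := fun s hs => by
    have : ∫ t in (3 / 16 : ℝ)..s, k t / 2 = ∫ t in (3 / 16 : ℝ)..s, (0 : ℝ) := by
      refine intervalIntegral.integral_congr fun t ht => ?_
      rw [uIcc_of_le hs] at ht
      simp [hk0 t ht.1]
    simpa only [hΦ_def, intervalIntegral.integral_zero] using this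
  have hφ0 : ∀ y : E, 7 / 16 ≤ ‖y‖ → Φ (‖y‖ ^ 2) = 0 := fun y hy => hΦ0 _ (by nlinarith)
  refine ⟨fun z => Φ (‖z‖ ^ 2), hΦ.comp (contDiff_norm_sq ℝ), ?_, fun y => ?_, fun y => ?_, ?_⟩
  · refine (closure_minimal (t := closedBall 0 (7 / 16)) (fun y hy => ?_)
      isClosed_closedBall).trans (closedBall_subset_ball (by norm_num))
    rw [mem_closedBall_zero_iff]
    by_contra! h
    exact hy (hφ0 y h.le)
  · rcases le_total (3 / 16) (‖y‖ ^ 2) with h | h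
    · simpa [hΦ0 _ h] using ha.le
    · have h2 : ‖Φ (‖y‖ ^ 2)‖ ≤ a / 2 * |‖y‖ ^ 2 - 3 / 16| := by
        refine intervalIntegral.norm_integral_le_of_norm_le_const fun t _ => ?_
        rw [Real.norm_of_nonneg (by have := hk_nonneg t; positivity)]
        linarith [hk_le t]
      have h3 : |‖y‖ ^ 2 - 3 / 16| ≤ 1 := by
        rw [abs_le]; constructor <;> nlinarith [sq_nonneg ‖y‖]
      rw [Real.norm_eq_abs] at h2
      nlinarith
  · rw [gradient_radial (hΦ' _), norm_smul, Real.norm_of_nonneg (hk_nonneg _)]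
    rcases le_total 1 ‖y‖ with h | h
    · rw [hk0 _ (by nlinarith)]
      simpa using ha.le
    · exact (mul_le_of_le_one_right (hk_nonneg _) h).trans (hk_le _)
  · have : Nontrivial E := nontrivial_of_finrank_pos (R := ℝ) (by omega)
    set p : ℝ → ℝ := fun r => k (r ^ 2) * r with hp_def
    have hp : ContDiff ℝ 1 p :=
      ((hk.comp (contDiff_id.pow 2)).mul contDiff_id).of_le (by exact_mod_cast le_top)
    rw [integral_congr_ae (Eventually.of_forall (curvDensity_radial hk hΦ')),
      integral_fun_norm_addHaar μ fun r => p r ^ 2 * deriv p r / (1 + p r ^ 2)]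
    obtain ⟨d, hd⟩ : ∃ d, finrank ℝ E = d + 2 := ⟨finrank ℝ E - 2, by omega⟩
    have hneg := integral_pow_mul_deriv_neg hp d
      (fun r hr => mul_nonneg (hk_nonneg _) hr) (fun r hr => by
        rw [hp_def]
        simp [hk0 (r ^ 2) (by nlinarith)]) (by simp [hp_def])
      ⟨√(1 / 8), by positivity, by
        have h1 : b (1 / 8) = 1 := b.one_of_mem_closedBall (mem_closedBall_self b.rIn_pos.le)
        simp only [hp_def, hk_def]
        rw [Real.sq_sqrt (by norm_num), h1]
        positivity⟩
    have hball : 0 < μ.real (ball (0 : E) 1) :=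
      ENNReal.toReal_pos (measure_ball_pos μ _ one_pos).ne' measure_ball_lt_top.ne
    rw [hd, nsmul_eq_mul, smul_eq_mul, show d + 2 - 1 = d + 1 by omega]
    simp only [smul_eq_mul]
    exact mul_neg_of_pos_of_neg (by positivity) (mul_neg_of_pos_of_neg hball hneg)

end Density

section Packing

variable {E : Type*} [NormedAddCommGroup E] [InnerProductSpace ℝ E] [FiniteDimensional ℝ E]

set_option linter.unusedSectionVars false

lemma curvDensity_congr {f g : E → ℝ} {y : E} (h : f =ᶠ[𝓝 y] g) :
    curvDensity f y = curvDensity g y := by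
  rw [curvDensity, curvDensity, h.gradient.fderiv_eq, h.gradient_eq]

lemma gradient_zero_fun (y : E) : gradient (fun _ : E => (0 : ℝ)) y = 0 := by
  simp [gradient]

lemma curvDensity_zero (y : E) : curvDensity (fun _ : E => (0 : ℝ)) y = 0 := by
  simp [curvDensity, gradient_zero_fun]

lemma curvDensity_eq_zero_of_notMem_tsupport {f : E → ℝ} {y : E} (h : y ∉ tsupport f) :
    curvDensity f y = 0 :=
  (curvDensity_congr (notMem_tsupport_iff_eventuallyEq.1 h)).trans (curvDensity_zero y)

lemma continuous_curvDensity {f : E → ℝ} (hf : ContDiff ℝ ∞ f) : Continuous (curvDensity f) := by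
  have h1 : Continuous (gradient f) := (contDiff_gradient hf).continuous
  have h2 : Continuous (fderiv ℝ (gradient f)) := (contDiff_gradient hf).continuous_fderiv (by simp)
  exact ((h2.clm_apply h1).inner h1).div (by fun_prop) fun y => by positivity

variable [MeasurableSpace E] [BorelSpace E] (μ : Measure E) [μ.IsAddHaarMeasure]

lemma integrable_curvDensity {f : E → ℝ} (hf : ContDiff ℝ ∞ f) (hs : HasCompactSupport f) :
    Integrable (curvDensity f) μ :=
  (continuous_curvDensity hf).integrable_of_hasCompactSupport
    (HasCompactSupport.intro hs fun _ => curvDensity_eq_zero_of_notMem_tsupport)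

lemma integral_fderiv_apply_eq_zero {g : E → ℝ} (hg : ContDiff ℝ 1 g) (hs : HasCompactSupport g)
    (v : E) : ∫ y, fderiv ℝ g y v ∂μ = 0 := by
  have h1 : Continuous fun y => fderiv ℝ g y v :=
    (hg.continuous_fderiv one_ne_zero).clm_apply continuous_const
  have h2 : HasCompactSupport fun y => fderiv ℝ g y v := hs.fderiv_apply ℝ v
  simpa using integral_mul_fderiv_eq_neg_fderiv_mul_of_integrable (μ := μ) (f := fun _ => (1 : ℝ))
    (g := g) (v := v) (by simp) (by simpa using h1.integrable_of_hasCompactSupport h2)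
    (by simpa using hg.continuous.integrable_of_hasCompactSupport hs)
    (fun _ _ => differentiableAt_const _) (fun y _ => hg.differentiable one_ne_zero y)

/-- The Laplacian of a compactly supported function has integral zero. -/
lemma integrable_trace_and_integral_eq_zero {f : E → ℝ} (hf : ContDiff ℝ ∞ f)
    (hs : HasCompactSupport f) :
    Integrable (fun y => LinearMap.trace ℝ E (fderiv ℝ (gradient f) y).toLinearMap) μ ∧
      ∫ y, LinearMap.trace ℝ E (fderiv ℝ (gradient f) y).toLinearMap ∂μ = 0 := by
  have hf1 : ContDiff ℝ ∞ (gradient f) := contDiff_gradient hf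
  set b := stdOrthonormalBasis ℝ E
  set g : Fin (finrank ℝ E) → E → ℝ := fun i y => ⟪b i, gradient f y⟫
  have hg : ∀ i, ContDiff ℝ 1 (g i) := fun i =>
    (contDiff_const.inner ℝ hf1).of_le (by exact_mod_cast le_top)
  have hgs : ∀ i, HasCompactSupport (g i) := fun i => HasCompactSupport.intro hs fun y hy => by
    have : gradient f y = 0 :=
      (notMem_tsupport_iff_eventuallyEq.1 hy).gradient_eq.trans (gradient_zero_fun y)
    simp only [g, this, inner_zero_right]
  have heq : (fun y => LinearMap.trace ℝ E (fderiv ℝ (gradient f) y).toLinearMap) =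
      fun y => ∑ i, fderiv ℝ (g i) y (b i) := by
    funext y
    rw [LinearMap.trace_eq_sum_inner _ b]
    refine Finset.sum_congr rfl fun i _ => ?_
    have h1 : HasFDerivAt (gradient f) (fderiv ℝ (gradient f) y) y :=
      (hf1.differentiable (by simp) y).hasFDerivAt
    have h2 : HasFDerivAt (g i) ((innerSL ℝ (b i)).comp (fderiv ℝ (gradient f) y)) y :=
      (innerSL ℝ (b i)).hasFDerivAt.comp y h1
    rw [h2.fderiv]
    rfl
  have hint : ∀ i, Integrable (fun y => fderiv ℝ (g i) y (b i)) μ := fun i =>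
    (((hg i).continuous_fderiv one_ne_zero).clm_apply
      continuous_const).integrable_of_hasCompactSupport ((hgs i).fderiv_apply ℝ (b i))
  rw [heq]
  refine ⟨integrable_finsetSum _ fun i _ => hint i, ?_⟩
  rw [integral_finsetSum _ fun i _ => hint i]
  exact Finset.sum_eq_zero fun i _ => integral_fderiv_apply_eq_zero μ (hg i) (hgs i) (b i)

/-- The copy of `φ` rescaled by `s` and centred at `s • v`. -/
def rescale (φ : E → ℝ) (s : ℝ) (v y : E) : ℝ := s * φ (s⁻¹ • y - v)

/-- The sum of the rescaled copies of `φ` centred at `s • v`, `v ∈ V`. -/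
def packing (φ : E → ℝ) (s : ℝ) (V : Finset E) (y : E) : ℝ := ∑ v ∈ V, rescale φ s v y

section

variable {φ : E → ℝ} (hφ : ContDiff ℝ ∞ φ) {s : ℝ} (hs : 0 < s)

include hφ

lemma contDiff_rescale (v : E) : ContDiff ℝ ∞ (rescale φ s v) :=
  contDiff_const.mul (hφ.comp ((contDiff_const.smul contDiff_id).sub contDiff_const))

lemma contDiff_packing (V : Finset E) : ContDiff ℝ ∞ (packing φ s V) :=
  ContDiff.sum fun v _ => contDiff_rescale hφ v

include hs

lemma gradient_rescale (v y : E) :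
    gradient (rescale φ s v) y = gradient φ (s⁻¹ • y - v) := by
  have h1 : HasFDerivAt φ (fderiv ℝ φ (s⁻¹ • y - v)) (s⁻¹ • y - v) :=
    (hφ.differentiable (by simp) _).hasFDerivAt
  have h2 : HasFDerivAt (fun y : E => s⁻¹ • y - v) (s⁻¹ • ContinuousLinearMap.id ℝ E) y :=
    ((hasFDerivAt_id y).const_smul s⁻¹).sub_const v
  refine gradient_eq_of_hasFDerivAt ((h1.comp y h2).const_mul s) fun w => ?_
  simp [inner_gradient_left, hs.ne']

lemma curvDensity_rescale (v y : E) :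
    curvDensity (rescale φ s v) y = s⁻¹ * curvDensity φ (s⁻¹ • y - v) := by
  have h1 : HasFDerivAt (gradient φ) (fderiv ℝ (gradient φ) (s⁻¹ • y - v)) (s⁻¹ • y - v) :=
    ((contDiff_gradient hφ).differentiable (by simp) _).hasFDerivAt
  have h2 : HasFDerivAt (fun y : E => s⁻¹ • y - v) (s⁻¹ • ContinuousLinearMap.id ℝ E) y :=
    ((hasFDerivAt_id y).const_smul s⁻¹).sub_const v
  have h3 : fderiv ℝ (gradient (rescale φ s v)) y =
      (fderiv ℝ (gradient φ) (s⁻¹ • y - v)).comp (s⁻¹ • ContinuousLinearMap.id ℝ E) := by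
    rw [funext (gradient_rescale hφ hs v)]
    exact (h1.comp y h2).fderiv
  rw [curvDensity, h3, gradient_rescale hφ hs, curvDensity]
  simp [mul_div_assoc]

omit hφ in
lemma rescale_eventuallyEq_zero {v y : E} (h : s⁻¹ • y - v ∉ tsupport φ) :
    rescale φ s v =ᶠ[𝓝 y] fun _ => 0 := by
  have hc : ContinuousAt (fun y : E => s⁻¹ • y - v) y := by fun_prop
  filter_upwards [hc.eventually (notMem_tsupport_iff_eventuallyEq.1 h)] with z hz
  simp [rescale, hz]

variable (hsupp : tsupport φ ⊆ ball 0 (1 / 2)) {V : Finset E}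
  (hV : ∀ v ∈ V, ∀ w ∈ V, v ≠ w → 1 ≤ dist v w)

include hsupp hV

omit hφ in
/-- Near each point at most one of the rescaled copies is nonzero. -/
lemma packing_local (y : E) :
    (packing φ s V =ᶠ[𝓝 y] (fun _ => 0) ∧ ∀ v ∈ V, rescale φ s v =ᶠ[𝓝 y] fun _ => 0) ∨
    ∃ v ∈ V, s⁻¹ • y - v ∈ ball 0 (1 / 2) ∧ packing φ s V =ᶠ[𝓝 y] rescale φ s v ∧
      ∀ w ∈ V, w ≠ v → rescale φ s w =ᶠ[𝓝 y] fun _ => 0 := by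
  by_cases h : ∃ v ∈ V, s⁻¹ • y - v ∈ ball 0 (1 / 2)
  · obtain ⟨v, hv, hvy⟩ := h
    have hzero : ∀ w ∈ V, w ≠ v → rescale φ s w =ᶠ[𝓝 y] fun _ => 0 := fun w hw hwv => by
      refine rescale_eventuallyEq_zero hs fun hmem => ?_
      have h1 := mem_ball_zero_iff.1 (hsupp hmem)
      have h2 := hV w hw v hv hwv
      rw [mem_ball_zero_iff] at hvy
      have h3 : dist w v ≤ ‖s⁻¹ • y - v‖ + ‖s⁻¹ • y - w‖ := by
        rw [dist_eq_norm, show w - v = (s⁻¹ • y - v) - (s⁻¹ • y - w) by abel]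
        exact norm_sub_le _ _
      linarith
    refine .inr ⟨v, hv, hvy, ?_, hzero⟩
    have : ∀ w ∈ V, ∀ᶠ z in 𝓝 y, w ≠ v → rescale φ s w z = 0 := fun w hw => by
      by_cases hwv : w = v
      · simp [hwv]
      · filter_upwards [hzero w hw hwv] with z hz _ using hz
    filter_upwards [(Filter.eventually_all_finset V).2 this] with z hz
    exact Finset.sum_eq_single_of_mem v hv hz
  · push Not at h
    have hzero : ∀ v ∈ V, rescale φ s v =ᶠ[𝓝 y] fun _ => 0 := fun v hv =>
      rescale_eventuallyEq_zero hs fun hmem => h v hv (hsupp hmem)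
    refine .inl ⟨?_, hzero⟩
    filter_upwards [(Filter.eventually_all_finset V).2 hzero] with z hz
    exact Finset.sum_eq_zero hz

omit hφ in
lemma abs_packing_le {a : ℝ} (ha : 0 ≤ a) (hb : ∀ y, |φ y| ≤ a) (y : E) :
    |packing φ s V y| ≤ s * a := by
  rcases packing_local hs hsupp hV y with ⟨h, -⟩ | ⟨v, -, -, h, -⟩
  · rw [h.eq_of_nhds]
    simp only [abs_zero]
    positivity
  · rw [h.eq_of_nhds, rescale, abs_mul, abs_of_pos hs]
    gcongr
    exact hb _

lemma norm_gradient_packing_le {a : ℝ} (ha : 0 ≤ a) (hb : ∀ y, ‖gradient φ y‖ ≤ a) (y : E) :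
    ‖gradient (packing φ s V) y‖ ≤ a := by
  rcases packing_local hs hsupp hV y with ⟨h, -⟩ | ⟨v, -, -, h, -⟩
  · rw [h.gradient_eq, gradient_zero_fun]
    simpa using ha
  · rw [h.gradient_eq, gradient_rescale hφ hs]
    exact hb _

omit hφ in
lemma packing_eq_zero {ρ : ℝ} (hVρ : ∀ v ∈ V, ‖v‖ ≤ ρ) {y : E} (hy : s * (ρ + 1 / 2) ≤ ‖y‖) :
    packing φ s V y = 0 := by
  rcases packing_local hs hsupp hV y with ⟨h, -⟩ | ⟨v, hv, hvy, -, -⟩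
  · exact h.eq_of_nhds
  · exfalso
    rw [mem_ball_zero_iff] at hvy
    have h1 : ‖s⁻¹ • y‖ < ρ + 1 / 2 := by
      calc ‖s⁻¹ • y‖ = ‖(s⁻¹ • y - v) + v‖ := by simp
        _ ≤ ‖s⁻¹ • y - v‖ + ‖v‖ := norm_add_le _ _
        _ < ρ + 1 / 2 := by linarith [hVρ v hv]
    rw [norm_smul, norm_inv, Real.norm_of_nonneg hs.le, inv_mul_lt_iff₀ hs] at h1
    linarith

lemma integral_curvDensity_packing :
    ∫ y, curvDensity (packing φ s V) y ∂μ =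
      V.card * (s⁻¹ * (s ^ finrank ℝ E * ∫ y, curvDensity φ y ∂μ)) := by
  have hc : HasCompactSupport φ :=
    HasCompactSupport.of_support_subset_isCompact (isCompact_closedBall 0 (1 / 2))
      ((subset_tsupport φ).trans (hsupp.trans ball_subset_closedBall))
  have hint := integrable_curvDensity μ hφ hc
  have h1 : ∀ y, curvDensity (packing φ s V) y = ∑ v ∈ V, curvDensity (rescale φ s v) y := by
    intro y
    have h0 : ∀ v, rescale φ s v =ᶠ[𝓝 y] (fun _ => 0) → curvDensity (rescale φ s v) y = 0 :=
      fun v hv => (curvDensity_congr hv).trans (curvDensity_zero y)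
    rcases packing_local hs hsupp hV y with ⟨hp, h⟩ | ⟨v, hv, hvy, hp, h⟩
    · rw [Finset.sum_eq_zero fun v hv => h0 v (h v hv)]
      exact (curvDensity_congr hp).trans (curvDensity_zero y)
    · rw [Finset.sum_eq_single_of_mem v hv fun w hw hwv => h0 w (h w hw hwv)]
      exact curvDensity_congr hp
  simp only [h1, curvDensity_rescale hφ hs]
  rw [integral_finsetSum _ fun v _ =>
    ((hint.comp_sub_right v).comp_smul (inv_ne_zero hs.ne')).const_mul _]
  have h2 : ∀ v, ∫ y, s⁻¹ * curvDensity φ (s⁻¹ • y - v) ∂μ =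
      s⁻¹ * (s ^ finrank ℝ E * ∫ y, curvDensity φ y ∂μ) := fun v => by
    rw [integral_const_mul, Measure.integral_comp_inv_smul_of_nonneg μ
      (fun y => curvDensity φ (y - v)) hs.le, integral_sub_right_eq_self (curvDensity φ) v,
      smul_eq_mul]
  simp [h2]

end

/-- A cubical lattice with `N ^ m` points. -/
lemma exists_lattice (m N : ℕ) : ∃ V : Finset (Euc m), V.card = N ^ m ∧
    (∀ v ∈ V, ∀ w ∈ V, v ≠ w → 1 ≤ dist v w) ∧ ∀ v ∈ V, ‖v‖ ≤ m * N := by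
  classical
  let L : (Fin m → Fin N) → Euc m := fun v => WithLp.toLp 2 fun i => ((v i : ℕ) : ℝ)
  have hL : Function.Injective L := fun v w h => by
    funext i
    have := congrArg (fun x : Euc m => x i) h
    simpa [L, Fin.ext_iff] using this
  refine ⟨Finset.univ.image L, ?_, ?_, ?_⟩
  · simp [Finset.card_image_of_injective _ hL]
  · simp only [Finset.mem_image, Finset.mem_univ, true_and]
    rintro _ ⟨v, rfl⟩ _ ⟨w, rfl⟩ hvw
    obtain ⟨i, hi⟩ : ∃ i, v i ≠ w i := by
      by_contra! h
      exact hvw (congrArg L (funext h))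
    have h1 : ((v i : ℕ) : ℤ) - (w i : ℕ) ≠ 0 := by
      rw [sub_ne_zero]
      exact_mod_cast Fin.val_ne_of_ne hi
    calc (1 : ℝ) ≤ |(((v i : ℕ) : ℤ) - (w i : ℕ) : ℤ)| := by exact_mod_cast Int.one_le_abs h1
      _ = ‖(L v - L w) i‖ := by simp [L]
      _ ≤ dist (L v) (L w) := by
        rw [dist_eq_norm]
        exact PiLp.norm_apply_le _ i
  · simp only [Finset.mem_image, Finset.mem_univ, true_and]
    rintro _ ⟨v, rfl⟩
    rw [← (EuclideanSpace.basisFun (Fin m) ℝ).sum_repr (L v)]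
    refine (norm_sum_le _ _).trans ?_
    have : ∀ i ∈ Finset.univ, ‖(EuclideanSpace.basisFun (Fin m) ℝ).repr (L v) i •
        EuclideanSpace.basisFun (Fin m) ℝ i‖ ≤ (N : ℝ) := fun i _ => by
      rw [norm_smul, (EuclideanSpace.basisFun (Fin m) ℝ).norm_eq_one, mul_one]
      simp [L]
    simpa using Finset.sum_le_card_nsmul _ _ _ this

end Packing

section Body

set_option linter.unusedSectionVars false

/-- The splitting of `ℝᵐ⁺¹` along the first coordinate vector. -/
lemma nonempty_splitting (m : ℕ) : Nonempty (Splitting (Euc m) (Euc (m + 1))) := by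
  have : Fact (finrank ℝ (Euc (m + 1)) = m + 1) := ⟨by simp⟩
  set e : Euc (m + 1) := EuclideanSpace.single 0 1
  have he : ‖e‖ = 1 := by simp [e]
  have he0 : e ≠ 0 := norm_ne_zero_iff.1 (by rw [he]; exact one_ne_zero)
  set b := OrthonormalBasis.fromOrthogonalSpanSingleton (𝕜 := ℝ) m he0
  refine ⟨⟨(Submodule.subtypeₗᵢ _).comp b.repr.symm.toLinearIsometry, e, he, fun y => ?_,
    fun x => ?_⟩⟩
  · exact Submodule.mem_orthogonal_singleton_iff_inner_left.1 (b.repr.symm y).2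
  · have hx : x - ⟪e, x⟫ • e ∈ (ℝ ∙ e)ᗮ := by
      rw [Submodule.mem_orthogonal_singleton_iff_inner_right, inner_sub_right, inner_smul_right,
        real_inner_self_eq_norm_sq, he]
      simp
    exact ⟨b.repr ⟨_, hx⟩, ⟪e, x⟫, by simp⟩

variable {E X : Type*} [NormedAddCommGroup E] [InnerProductSpace ℝ E] [FiniteDimensional ℝ E]
  [NormedAddCommGroup X] [InnerProductSpace ℝ X] [FiniteDimensional ℝ X]

/-- Normalization is Lipschitz away from the origin. -/
lemma norm_normalize_sub_normalize_le (a : X) {b : X} (hb : b ≠ 0) :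
    ‖‖a‖⁻¹ • a - ‖b‖⁻¹ • b‖ ≤ 2 * ‖a - b‖ / ‖b‖ := by
  have hb' : 0 < ‖b‖ := norm_pos_iff.2 hb
  have h1 : ‖a‖⁻¹ • a - ‖b‖⁻¹ • b =
      ‖b‖⁻¹ • ((‖b‖ - ‖a‖) • (‖a‖⁻¹ • a)) + ‖b‖⁻¹ • (a - b) := by
    rcases eq_or_ne a 0 with rfl | ha
    · simp
    · have ha' : ‖a‖ ≠ 0 := norm_ne_zero_iff.2 ha
      have : ‖b‖⁻¹ * (‖b‖ - ‖a‖) * ‖a‖⁻¹ + ‖b‖⁻¹ = ‖a‖⁻¹ := by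
        field_simp
        ring
      rw [smul_smul, smul_smul, smul_sub, ← add_sub_assoc, ← add_smul, this]
  rw [h1]
  refine (norm_add_le _ _).trans ?_
  rw [norm_smul, norm_smul, norm_smul _ (a - b), norm_inv, norm_norm, ← mul_add,
    div_eq_inv_mul, two_mul]
  gcongr
  have h2 : ‖‖a‖⁻¹ • a‖ ≤ 1 := by
    rw [norm_smul, norm_inv, norm_norm]
    exact inv_mul_le_one
  calc ‖‖b‖ - ‖a‖‖ * ‖‖a‖⁻¹ • a‖ ≤ ‖‖b‖ - ‖a‖‖ * 1 := by gcongr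
    _ ≤ ‖a - b‖ := by
      rw [mul_one, norm_sub_rev a b]
      exact abs_norm_sub_norm_le b a

namespace Splitting

variable (S : Splitting E X)

/-- The perturbation of `1 - ‖y‖²` by `q`. -/
def _root_.perturbed (q : E → ℝ) (y : E) : ℝ := 1 - ‖y‖ ^ 2 + q y

lemma defFun_perturbed (q : E → ℝ) (x : X) :
    S.defFun (perturbed q) x = ‖x‖ ^ 2 - 1 - q (S.proj x) := by
  rw [defFun, perturbed, S.norm_sq_eq]
  ring

variable {q : E → ℝ} (hq : ContDiff ℝ ∞ q)

include hq

lemma _root_.contDiff_perturbed : ContDiff ℝ ∞ (perturbed q) :=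
  (contDiff_const.sub (contDiff_norm_sq ℝ)).add hq

lemma gradient_defFun_perturbed (x : X) :
    gradient (S.defFun (perturbed q)) x = (2 : ℝ) • x - S.ι (gradient q (S.proj x)) := by
  have h1 : HasFDerivAt q (fderiv ℝ q (S.proj x)) (S.proj x) :=
    (hq.differentiable (by simp) _).hasFDerivAt
  have h2 : HasFDerivAt (fun y : E => ‖y‖ ^ 2) ((2 * 1 : ℝ) • innerSL ℝ (S.proj x)) (S.proj x) :=
    hasFDerivAt_radial (Φ := id) (hasDerivAt_id _)
  have h3 : gradient (perturbed q) (S.proj x) = gradient q (S.proj x) - (2 : ℝ) • S.proj x := by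
    refine gradient_eq_of_hasFDerivAt (((hasFDerivAt_const 1 _).sub h2).add h1) fun v => ?_
    simp [inner_sub_left, inner_smul_left, inner_gradient_left]
    ring
  rw [S.gradient_defFun (contDiff_perturbed hq), h3]
  conv_rhs => rw [← S.decomp x]
  simp
  module

variable (hq_le : ∀ y, |q y| ≤ 1 / 2) (hq_zero : ∀ y, 1 / 2 ≤ ‖y‖ → q y = 0)

include hq_le

lemma half_le_norm_sq {x : X} (hx : S.defFun (perturbed q) x = 0) : 1 / 2 ≤ ‖x‖ ^ 2 := by
  rw [defFun_perturbed] at hx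
  linarith [(abs_le.1 (hq_le (S.proj x))).1]

omit hq in
lemma isBounded_defFun_perturbed :
    Bornology.IsBounded {x : X | S.defFun (perturbed q) x ≤ 0} := by
  refine (isBounded_closedBall (x := 0) (r := 2)).subset fun x hx => ?_
  replace hx : S.defFun (perturbed q) x ≤ 0 := hx
  rw [defFun_perturbed] at hx
  rw [mem_closedBall_zero_iff]
  nlinarith [(abs_le.1 (hq_le (S.proj x))).2, norm_nonneg x]

include hq_zero

lemma isConnected_defFun_perturbed : IsConnected {x : X | S.defFun (perturbed q) x < 0} := by
  have hpos : ∀ y, 0 < perturbed q y ↔ ‖y‖ < 1 := fun y => by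
    rw [perturbed]
    rcases le_total (1 / 2) ‖y‖ with h | h
    · rw [hq_zero y h]
      constructor <;> intro h' <;> nlinarith
    · have := (abs_le.1 (hq_le y)).1
      constructor <;> intro h' <;> nlinarith [norm_nonneg y]
  have hc : Continuous fun z : E × ℝ => S.ι z.1 + (z.2 * √(perturbed q z.1)) • S.e := by
    have := (contDiff_perturbed hq).continuous
    have := S.ι.continuous
    fun_prop
  have himage : {x : X | S.defFun (perturbed q) x < 0} =
      (fun z : E × ℝ => S.ι z.1 + (z.2 * √(perturbed q z.1)) • S.e) ''
        (ball 0 1 ×ˢ ball 0 1) := by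
    ext x
    simp only [mem_ofPred_eq, mem_image, mem_prod, mem_ball_zero_iff, Prod.exists]
    constructor
    · intro hx
      have hx' : S.height x ^ 2 < perturbed q (S.proj x) := sub_neg.1 hx
      have hu : 0 < perturbed q (S.proj x) := (sq_nonneg _).trans_lt hx'
      refine ⟨S.proj x, S.height x / √(perturbed q (S.proj x)), ⟨(hpos _).1 hu, ?_⟩, ?_⟩
      · rw [norm_div, Real.norm_of_nonneg (Real.sqrt_nonneg _), div_lt_one (Real.sqrt_pos.2 hu)]
        exact Real.lt_sqrt_of_sq_lt (by simpa using hx')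
      · rw [div_mul_cancel₀ _ (Real.sqrt_pos.2 hu).ne', S.decomp]
    · rintro ⟨y, r, ⟨hy, hr⟩, rfl⟩
      have hu := (hpos y).2 hy
      have hr' : r ^ 2 < 1 := by
        rw [← sq_abs]
        have := abs_nonneg r
        rw [Real.norm_eq_abs] at hr
        nlinarith
      simp only [defFun, map_add, proj_ι, map_smul, proj_e, height_ι, height_e, smul_zero, add_zero,
        zero_add, smul_eq_mul, mul_one, mul_pow, Real.sq_sqrt hu.le]
      nlinarith
  rw [himage]
  refine IsConnected.image ?_ _ hc.continuousOn
  exact ⟨⟨(0, 0), by simp⟩,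
    ((convex_ball 0 1).prod (convex_ball 0 1)).isPreconnected⟩

end Splitting

/-- The body `{t² < 1 - ‖y‖² + q(y)}`. -/
def perturbedBody {m : ℕ} (S : Splitting (Euc m) (Euc (m + 1))) {q : Euc m → ℝ}
    (hq : ContDiff ℝ ∞ q) (hq_le : ∀ y, |q y| ≤ 1 / 2) (hq_zero : ∀ y, 1 / 2 ≤ ‖y‖ → q y = 0)
    (hq_grad : ∀ y, ‖gradient q y‖ ≤ 1 / 2) : SmoothBody (m + 1) where
  F := S.defFun (perturbed q)
  smooth := S.contDiff_defFun (contDiff_perturbed hq)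
  bounded := S.isBounded_defFun_perturbed hq_le
  connected := S.isConnected_defFun_perturbed hq hq_le hq_zero
  regular x hx h0 := by
    have h1 := S.half_le_norm_sq hq hq_le hx
    rw [S.gradient_defFun_perturbed hq, sub_eq_zero] at h0
    have h2 := congrArg norm h0
    rw [norm_smul, S.ι.norm_map, Real.norm_two] at h2
    have h3 := hq_grad (S.proj x)
    nlinarith [norm_nonneg x]

lemma isPerturbedBall_perturbedBody {m : ℕ} (S : Splitting (Euc m) (Euc (m + 1))) {q : Euc m → ℝ}
    (hq : ContDiff ℝ ∞ q) (hq_le : ∀ y, |q y| ≤ 1 / 2) (hq_zero : ∀ y, 1 / 2 ≤ ‖y‖ → q y = 0)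
    (hq_grad : ∀ y, ‖gradient q y‖ ≤ 1 / 2) {ε : ℝ} (hε : ∀ y, ‖gradient q y‖ ≤ ε / 2) :
    (perturbedBody S hq hq_le hq_zero hq_grad).IsPerturbedBall ε := by
  refine ⟨0, fun x hx => ?_⟩
  have h1 : 1 / 2 ≤ ‖x‖ := by
    have := S.half_le_norm_sq hq hq_le hx
    nlinarith [norm_nonneg x]
  have h0 : (2 : ℝ) • x ≠ 0 := smul_ne_zero two_ne_zero (norm_pos_iff.1 (by linarith))
  have h2 := norm_normalize_sub_normalize_le (gradient (S.defFun (perturbed q)) x) h0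
  have h3 : ‖(2 : ℝ) • x‖⁻¹ • (2 : ℝ) • x = ‖x‖⁻¹ • x := by
    rw [norm_smul, smul_smul, mul_inv, Real.norm_two]
    congr 1
    ring
  rw [h3, S.gradient_defFun_perturbed hq, sub_sub_cancel_left, norm_neg, S.ι.norm_map, norm_smul,
    Real.norm_two, ← S.gradient_defFun_perturbed hq] at h2
  rw [sub_zero]
  refine h2.trans ?_
  rw [div_le_iff₀ (by linarith)]
  have := hε (S.proj x)
  nlinarith [norm_nonneg (gradient q (S.proj x))]

end Body

section Total

lemma gradient_const_mul_one_add {E : Type*} [NormedAddCommGroup E] [InnerProductSpace ℝ E]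
    [FiniteDimensional ℝ E] {f : E → ℝ} (hf : ContDiff ℝ ∞ f) (σ : ℝ) (y : E) :
    gradient (fun z => σ * (1 + f z)) y = σ • gradient f y := by
  have h1 : HasFDerivAt f (fderiv ℝ f y) y := (hf.differentiable (by simp) _).hasFDerivAt
  refine gradient_eq_of_hasFDerivAt ((h1.const_add 1).const_mul σ) fun v => ?_
  rw [real_inner_smul_left, inner_gradient_left]
  simp

variable {m : ℕ} (S : Splitting (Euc m) (Euc (m + 1))) (K : SmoothBody (m + 1)) {u f : Euc m → ℝ}
  (hu : ContDiff ℝ ∞ u) (hK : K.F = S.defFun u) (hf : ContDiff ℝ ∞ f)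
  (hf_pos : ∀ y, 0 < 1 + f y) {R : ℝ} (huf : ∀ y, ‖y‖ < R → u y = (1 + f y) ^ 2)

include hu hK hf hf_pos huf

/-- The total mean curvature of a cap of `∂K` that is the graph of `±(1 + f)`. -/
lemma integral_meanCurv_cap {σ : ℝ} (hσ : σ ^ 2 = 1) :
    ∫ x in graphMap S.ι S.e (fun y => σ * (1 + f y)) '' ball 0 R, K.meanCurv x
        ∂μH[finrank ℝ (Euc m)] =
      ∫ y in ball 0 R, (curvDensity f y -
        LinearMap.trace ℝ (Euc m) (fderiv ℝ (gradient f) y).toLinearMap)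
        ∂μH[finrank ℝ (Euc m)] := by
  have hw : ContDiff ℝ ∞ fun y => σ * (1 + f y) := contDiff_const.mul (contDiff_const.add hf)
  rw [setIntegral_graphMap S.ι S.norm_e S.inner_ι_e (hw.of_le (by exact_mod_cast le_top))
    measurableSet_ball]
  refine setIntegral_congr_fun measurableSet_ball fun y hy => ?_
  have hgrad : gradient (fun z => 1 + f z) = gradient f := funext fun z => by
    simpa using gradient_const_mul_one_add hf 1 z
  have hnorm : ‖gradient (fun z => σ * (1 + f z)) y‖ ^ 2 = ‖gradient f y‖ ^ 2 := by
    rw [gradient_const_mul_one_add hf, norm_smul, mul_pow, Real.norm_eq_abs, sq_abs, hσ, one_mul]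
  have huw : u =ᶠ[𝓝 y] fun z => (1 + f z) ^ 2 := by
    filter_upwards [isOpen_ball.mem_nhds hy] with z hz using huf z (mem_ball_zero_iff.1 hz)
  have key := S.sqrt_mul_trace_fderiv_normal hu (contDiff_const.add hf) huw (hf_pos y) hσ
  rw [hgrad] at key
  rw [hnorm, curvDensity, ← key]
  simp only [SmoothBody.meanCurv, divg, graphMap]
  unfold SmoothBody.normal
  rw [hK]

/-- The caps contribute twice the integral of the curvature density. -/
lemma integral_meanCurv_eq {ρ : ℝ} (hρ : ρ < R) (hf_zero : ∀ y, ρ ≤ ‖y‖ → f y = 0) :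
    ∫ x in K.bdry, K.meanCurv x ∂μH[finrank ℝ (Euc m)] =
      ∫ x in {x | x ∈ K.bdry ∧ R ≤ ‖S.proj x‖}, K.meanCurv x ∂μH[finrank ℝ (Euc m)] +
        2 * ∫ y, curvDensity f y ∂μH[finrank ℝ (Euc m)] := by
  have hts : tsupport f ⊆ closedBall 0 ρ := by
    refine closure_minimal (fun y hy => ?_) isClosed_closedBall
    rw [mem_closedBall_zero_iff]
    by_contra! h
    exact hy (hf_zero y h.le)
  have hcs : HasCompactSupport f :=
    (isCompact_closedBall 0 ρ).of_isClosed_subset (isClosed_tsupport f) hts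
  obtain ⟨htr, htr0⟩ := integrable_trace_and_integral_eq_zero μH[finrank ℝ (Euc m)] hf hcs
  have hcap : ∫ y in ball 0 R, (curvDensity f y -
      LinearMap.trace ℝ (Euc m) (fderiv ℝ (gradient f) y).toLinearMap)
      ∂μH[finrank ℝ (Euc m)] = ∫ y, curvDensity f y ∂μH[finrank ℝ (Euc m)] := by
    rw [setIntegral_eq_integral_of_forall_compl_eq_zero fun y hy => ?_,
      integral_sub (integrable_curvDensity _ hf hcs) htr, htr0, sub_zero]
    have hy' : y ∉ tsupport f := fun h => hy (closedBall_subset_ball hρ (hts h))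
    have h0 : gradient f =ᶠ[𝓝 y] fun _ => 0 :=
      (notMem_tsupport_iff_eventuallyEq.1 hy').gradient.trans
        (Eventually.of_forall gradient_zero_fun)
    rw [curvDensity_eq_zero_of_notMem_tsupport hy', h0.fderiv_eq]
    simp
  set C : ℝ → Set (Euc (m + 1)) := fun σ =>
    graphMap S.ι S.e (fun y => σ * (1 + f y)) '' ball 0 R with hC
  set T : Set (Euc (m + 1)) := {x | x ∈ K.bdry ∧ R ≤ ‖S.proj x‖}
  have hmeas : ∀ σ, MeasurableSet (C σ) := fun σ =>
    (measurableEmbedding_graphMap S.ι S.norm_e S.inner_ι_e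
      (continuous_const.mul (continuous_const.add hf.continuous))).measurableSet_image.2
        measurableSet_ball
  have hTmeas : MeasurableSet T :=
    (K.isClosed_bdry.inter (isClosed_le continuous_const S.proj.continuous.norm)).measurableSet
  have hmemC : ∀ σ x, x ∈ C σ ↔ ‖S.proj x‖ < R ∧ S.height x = σ * (1 + f (S.proj x)) := by
    intro σ x
    constructor
    · rintro ⟨y, hy, rfl⟩
      simpa [graphMap] using hy
    · rintro ⟨h1, h2⟩
      refine ⟨S.proj x, mem_ball_zero_iff.2 h1, ?_⟩
      rw [graphMap, ← h2, S.decomp]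
  have hmem : ∀ x, x ∈ K.bdry ↔ S.height x ^ 2 = u (S.proj x) := fun x => by
    rw [← sub_eq_zero]
    change K.F x = 0 ↔ _
    rw [hK]
    rfl
  have hbdry : K.bdry = T ∪ (C 1 ∪ C (-1)) := by
    ext x
    simp only [mem_union, hmemC]
    rcases lt_or_ge ‖S.proj x‖ R with h | h
    · have : x ∉ T := fun hx => not_le.2 h hx.2
      simp only [this, false_or, h, true_and, hmem, huf _ h, sq_eq_sq_iff_eq_or_eq_neg, one_mul,
        neg_one_mul]
    · simp only [not_lt.2 h, false_and, or_false]
      exact ⟨fun hx => ⟨hx, h⟩, fun hx => hx.1⟩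
  have hint : IntegrableOn K.meanCurv K.bdry μH[finrank ℝ (Euc m)] := by
    simpa using K.integrableOn_meanCurv
  have hd1 : Disjoint T (C 1 ∪ C (-1)) := by
    rw [Set.disjoint_left]
    rintro x hx (h | h)
    · exact not_le.2 ((hmemC _ _).1 h).1 hx.2
    · exact not_le.2 ((hmemC _ _).1 h).1 hx.2
  have hd2 : Disjoint (C 1) (C (-1)) := by
    rw [Set.disjoint_left]
    intro x h1 h2
    have := ((hmemC _ _).1 h1).2.symm.trans ((hmemC _ _).1 h2).2
    linarith [hf_pos (S.proj x)]
  rw [hbdry] at hint ⊢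
  rw [setIntegral_union hd1 ((hmeas _).union (hmeas _)) hint.left_of_union hint.right_of_union,
    setIntegral_union hd2 (hmeas _) hint.right_of_union.left_of_union
      hint.right_of_union.right_of_union]
  simp only [hC]
  rw [integral_meanCurv_cap S K hu hK hf hf_pos huf (one_pow 2),
    integral_meanCurv_cap S K hu hK hf hf_pos huf (by norm_num), hcap]
  ring

omit hf hf_pos huf hu in
/-- The part of the total mean curvature over `{R ≤ ‖y‖}` only depends on the defining function
near that set. -/
lemma setIntegral_meanCurv_congr {u₀ : Euc m → ℝ} (h : ∀ y, R ≤ ‖y‖ → u =ᶠ[𝓝 y] u₀) :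
    ∫ x in {x | x ∈ K.bdry ∧ R ≤ ‖S.proj x‖}, K.meanCurv x ∂μH[finrank ℝ (Euc m)] =
      ∫ x in {x | S.defFun u₀ x = 0 ∧ R ≤ ‖S.proj x‖},
        divg (fun x => ‖gradient (S.defFun u₀) x‖⁻¹ • gradient (S.defFun u₀) x) x
        ∂μH[finrank ℝ (Euc m)] := by
  have hset : {x | x ∈ K.bdry ∧ R ≤ ‖S.proj x‖} =
      {x | S.defFun u₀ x = 0 ∧ R ≤ ‖S.proj x‖} := by
    ext x
    refine and_congr_left fun hx => ?_
    change K.F x = 0 ↔ _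
    rw [hK, Splitting.defFun, Splitting.defFun, (h _ hx).eq_of_nhds]
  have hmeas : MeasurableSet {x | x ∈ K.bdry ∧ R ≤ ‖S.proj x‖} :=
    (K.isClosed_bdry.inter (isClosed_le continuous_const S.proj.continuous.norm)).measurableSet
  rw [← hset]
  refine setIntegral_congr_fun hmeas fun x hx => ?_
  have h1 : K.F =ᶠ[𝓝 x] S.defFun u₀ := by
    rw [hK]
    filter_upwards [S.proj.continuous.continuousAt.eventually (h _ hx.2)] with z hz
    rw [Splitting.defFun, Splitting.defFun, hz]
  have h2 : K.normal =ᶠ[𝓝 x]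
      fun x => ‖gradient (S.defFun u₀) x‖⁻¹ • gradient (S.defFun u₀) x := by
    filter_upwards [h1.gradient] with z hz
    rw [SmoothBody.normal, hz]
  simp only [SmoothBody.meanCurv, divg, h2.fderiv_eq]

end Total

section Construction

/-- A small perturbation that flattens the paraboloid `1 - ‖y‖²` near the origin. -/
lemma exists_flattening (m : ℕ) {κ : ℝ} (hκ : 0 < κ) : ∃ (q : Euc m → ℝ) (r : ℝ), 0 < r ∧ r ≤ 1 ∧
    ContDiff ℝ ∞ q ∧ (∀ y, ‖y‖ < r → q y = ‖y‖ ^ 2) ∧ (∀ y, |q y| ≤ 1 / 4) ∧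
    (∀ y, 1 / 2 ≤ ‖y‖ → q y = 0) ∧ ∀ y, ‖gradient q y‖ ≤ κ := by
  set ζ : ContDiffBump (0 : Euc m) := ⟨1, 2, one_pos, one_lt_two⟩
  set p : Euc m → ℝ := fun y => ‖y‖ ^ 2 * ζ y with hp_def
  have hp : ContDiff ℝ ∞ p := (contDiff_norm_sq ℝ).mul ζ.contDiff
  have hp_zero : ∀ y, 2 ≤ ‖y‖ → p y = 0 := fun y hy => by
    rw [hp_def]
    simp only
    rw [ζ.zero_of_le_dist (by simpa [ζ] using hy), mul_zero]
  have hp_le : ∀ y, |p y| ≤ 4 := fun y => by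
    rcases le_total 2 ‖y‖ with hy | hy
    · rw [hp_zero y hy]
      norm_num
    · rw [abs_of_nonneg (mul_nonneg (sq_nonneg _) ζ.nonneg)]
      have h1 := ζ.le_one (x := y)
      have h2 : ‖y‖ ^ 2 ≤ 4 := by nlinarith [norm_nonneg y]
      exact (mul_le_mul h2 h1 ζ.nonneg (by norm_num)).trans (by norm_num)
  have hcs : HasCompactSupport (gradient p) := by
    refine HasCompactSupport.of_support_subset_isCompact (isCompact_closedBall 0 2) fun y hy => ?_
    rw [mem_closedBall_zero_iff]
    by_contra! h
    refine hy ?_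
    have : p =ᶠ[𝓝 y] fun _ => 0 := by
      filter_upwards [(isOpen_lt continuous_const continuous_norm).mem_nhds h] with z hz
      exact hp_zero z (le_of_lt hz)
    rw [this.gradient.eq_of_nhds, gradient_zero_fun]
  have hgc : Continuous (gradient p) :=
    (InnerProductSpace.toDual ℝ (Euc m)).symm.continuous.comp (hp.continuous_fderiv (by simp))
  obtain ⟨M, hM⟩ := hgc.bounded_above_of_compact_support hcs
  have hM0 : 0 ≤ M := (norm_nonneg _).trans (hM 0)
  set r : ℝ := min (1 / 4) (κ / (M + 1))
  have hr : 0 < r := lt_min (by norm_num) (by positivity)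
  have hr4 : r ≤ 1 / 4 := min_le_left _ _
  have hrM : r * M ≤ κ := by
    have : r * (M + 1) ≤ κ := (le_div_iff₀ (by positivity)).1 (min_le_right _ _)
    linarith
  have hgrad : ∀ y, gradient (fun y => r * rescale p r 0 y) y = r • gradient p (r⁻¹ • y) := by
    intro y
    have h1 : HasFDerivAt (rescale p r 0) (fderiv ℝ (rescale p r 0) y) y :=
      ((contDiff_rescale hp 0).differentiable (by simp) _).hasFDerivAt
    refine gradient_eq_of_hasFDerivAt (h1.const_mul r) fun v => ?_
    have := gradient_rescale hp hr 0 y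
    rw [sub_zero] at this
    rw [← this, real_inner_smul_left, inner_gradient_left]
    simp
  have hnorm : ∀ y : Euc m, ‖r⁻¹ • y‖ = r⁻¹ * ‖y‖ := fun y => by
    rw [norm_smul, Real.norm_of_nonneg (inv_nonneg.2 hr.le)]
  refine ⟨fun y => r * rescale p r 0 y, r, hr, by linarith,
    contDiff_const.mul (contDiff_rescale hp 0), fun y hy => ?_, fun y => ?_, fun y hy => ?_,
    fun y => ?_⟩
  · have : ζ (r⁻¹ • y) = 1 := by
      refine ζ.one_of_mem_closedBall ?_
      rw [mem_closedBall_zero_iff, hnorm, inv_mul_le_iff₀ hr]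
      simpa [ζ] using hy.le
    simp only [rescale, sub_zero, hp_def, this, hnorm]
    field_simp
  · simp only [rescale, abs_mul, abs_of_pos hr]
    have h1 := hp_le (r⁻¹ • y - 0)
    have : r * (r * |p (r⁻¹ • y - 0)|) ≤ 1 / 4 * (1 / 4 * 4) := by gcongr
    linarith
  · simp only [rescale, sub_zero]
    rw [hp_zero _ (by rw [hnorm, le_inv_mul_iff₀ hr]; linarith), mul_zero, mul_zero]
  · rw [hgrad, norm_smul, Real.norm_of_nonneg hr.le]
    exact (mul_le_mul_of_nonneg_left (hM _) hr.le).trans hrM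

lemma gradient_add_two_mul_add_sq {E : Type*} [NormedAddCommGroup E] [InnerProductSpace ℝ E]
    [FiniteDimensional ℝ E] {q f : E → ℝ} (hq : ContDiff ℝ ∞ q) (hf : ContDiff ℝ ∞ f) (y : E) :
    gradient (fun z => q z + (2 * f z + f z ^ 2)) y =
      gradient q y + (2 * (1 + f y)) • gradient f y := by
  have h1 : HasFDerivAt q (fderiv ℝ q y) y := (hq.differentiable (by simp) _).hasFDerivAt
  have h2 : HasFDerivAt f (fderiv ℝ f y) y := (hf.differentiable (by simp) _).hasFDerivAt
  refine gradient_eq_of_hasFDerivAt (h1.add ((h2.const_mul 2).add (h2.pow 2))) fun v => ?_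
  rw [inner_add_left, real_inner_smul_left, inner_gradient_left, inner_gradient_left]
  simp
  ring

end Construction

/-- For every `n ≥ 3` and every `ε > 0` there exists a bounded domain
`K ⊆ ℝⁿ` with smooth boundary which is a `C¹` `ε`-perturbation of a ball and satisfies
`∫_{∂K} H dH^{n-1} < −1`. -/
theorem exists_perturbation_with_negative_total_mean_curvature
    (n : ℕ) (hn : 3 ≤ n) (ε : ℝ) (hε : 0 < ε) :
    ∃ K : SmoothBody n, K.IsPerturbedBall ε ∧
      (∫ x in K.bdry, K.meanCurv x ∂μH[(n : ℝ) - 1]) < -1 := by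
  obtain ⟨m, rfl⟩ : ∃ m, n = m + 1 := ⟨n - 1, by omega⟩
  have hm : 2 ≤ m := by omega
  have hdim : ((m + 1 : ℕ) : ℝ) - 1 = (finrank ℝ (Euc m) : ℝ) := by simp
  rw [hdim]
  obtain ⟨S⟩ := nonempty_splitting m
  set κ : ℝ := min (1 / 2) (ε / 2)
  have hκ : 0 < κ := lt_min (by norm_num) (by linarith)
  obtain ⟨q₀, r, hr, hr1, hq₀, hq₀_sq, hq₀_le, hq₀_zero, hq₀_grad⟩ :=
    exists_flattening m (half_pos hκ)
  set a : ℝ := min (1 / 16) (κ / 8)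
  have ha : 0 < a := lt_min (by norm_num) (by linarith)
  have ha16 : a ≤ 1 / 16 := min_le_left _ _
  have haκ : a ≤ κ / 8 := min_le_right _ _
  obtain ⟨φ, hφ, hsupp, hφ_le, hφ_grad, hφ_neg⟩ :=
    exists_bump_curvDensity_neg μH[finrank ℝ (Euc m)] (E := Euc m) (by simpa using hm) ha
  set J := ∫ y, curvDensity φ y ∂μH[finrank ℝ (Euc m)]
  set c₀ := ∫ x in {x | S.defFun (perturbed q₀) x = 0 ∧ r ≤ ‖S.proj x‖},
    divg (fun x => ‖gradient (S.defFun (perturbed q₀)) x‖⁻¹ •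
      gradient (S.defFun (perturbed q₀)) x) x ∂μH[finrank ℝ (Euc m)]
  set δ : ℝ := r / (m + 1)
  have hm0 : (0 : ℝ) < m + 1 := by positivity
  have hδ : 0 < δ := by positivity
  have hδr : δ * (m + 1) = r := div_mul_cancel₀ _ hm0.ne'
  have hδ1 : δ ≤ 1 := by nlinarith
  set b : ℝ := δ ^ (m - 1) * -J
  have hb : 0 < b := mul_pos (by positivity) (by linarith)
  obtain ⟨N, hN⟩ := exists_nat_gt (max 1 ((c₀ + 1) / b))
  have hN1 : (1 : ℝ) < N := (le_max_left _ _).trans_lt hN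
  have hNb : c₀ + 1 < N * b := (div_lt_iff₀ hb).1 ((le_max_right _ _).trans_lt hN)
  have hN0 : (0 : ℝ) < N := by linarith
  obtain ⟨V, hVcard, hV, hVnorm⟩ := exists_lattice m N
  set s : ℝ := δ / N
  have hs : 0 < s := by positivity
  have hs1 : s ≤ 1 := (div_le_one hN0).2 (by linarith)
  set f := packing φ s V
  have hf : ContDiff ℝ ∞ f := contDiff_packing hφ V
  have hf_le : ∀ y, |f y| ≤ a := fun y =>
    (abs_packing_le hs hsupp hV ha.le hφ_le y).trans (mul_le_of_le_one_left ha.le hs1)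
  have hf_grad : ∀ y, ‖gradient f y‖ ≤ a := norm_gradient_packing_le hφ hs hsupp hV ha.le hφ_grad
  have hf_pos : ∀ y, 0 < 1 + f y := fun y => by linarith [(abs_le.1 (hf_le y)).1]
  set ρ : ℝ := δ * (m + 1 / 2)
  have hρ : ρ < r := by
    rw [← hδr]
    exact mul_lt_mul_of_pos_left (by linarith) hδ
  have hf_zero : ∀ y, ρ ≤ ‖y‖ → f y = 0 := fun y hy => by
    refine packing_eq_zero hs hsupp hV hVnorm (le_trans ?_ hy)
    have h1 : s * (m * N + 1 / 2) = δ * (m + 1 / (2 * N)) := by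
      simp only [s]
      field_simp
    rw [h1]
    refine mul_le_mul_of_nonneg_left ?_ hδ.le
    gcongr
    linarith
  set q : Euc m → ℝ := fun y => q₀ y + (2 * f y + f y ^ 2)
  have hq : ContDiff ℝ ∞ q := hq₀.add ((contDiff_const.mul hf).add (hf.pow 2))
  have hq_le : ∀ y, |q y| ≤ 1 / 2 := fun y => by
    have h1 := abs_le.1 (hq₀_le y)
    have h2 := abs_le.1 (hf_le y)
    rw [abs_le]
    constructor <;> simp only [q] <;> nlinarith
  have hq_zero : ∀ y, 1 / 2 ≤ ‖y‖ → q y = 0 := fun y hy => by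
    by_cases h : ρ ≤ ‖y‖
    · simp only [q, hq₀_zero y hy, hf_zero y h]
      norm_num
    · have h1 := hq₀_sq y ((not_le.1 h).trans hρ)
      rw [hq₀_zero y hy] at h1
      nlinarith
  have hq_grad : ∀ y, ‖gradient q y‖ ≤ κ := fun y => by
    rw [gradient_add_two_mul_add_sq hq₀ hf]
    refine (norm_add_le _ _).trans ?_
    rw [norm_smul, Real.norm_of_nonneg (by linarith [hf_pos y])]
    have h1 := (abs_le.1 (hf_le y)).2
    have h2 : 2 * (1 + f y) * ‖gradient f y‖ ≤ 4 * a :=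
      mul_le_mul (by linarith) (hf_grad y) (norm_nonneg _) (by norm_num)
    linarith [hq₀_grad y]
  have hq_grad' : ∀ y, ‖gradient q y‖ ≤ 1 / 2 := fun y => (hq_grad y).trans (min_le_left _ _)
  set K := perturbedBody S hq hq_le hq_zero hq_grad'
  have hK : K.F = S.defFun (perturbed q) := rfl
  refine ⟨K, isPerturbedBall_perturbedBody S hq hq_le hq_zero hq_grad'
    fun y => (hq_grad y).trans (min_le_right _ _), ?_⟩
  have hcap : ∀ y, ‖y‖ < r → perturbed q y = (1 + f y) ^ 2 := fun y hy => by
    simp only [perturbed, q, hq₀_sq y hy]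
    ring
  have hfar : ∀ y, r ≤ ‖y‖ → perturbed q =ᶠ[𝓝 y] perturbed q₀ := fun y hy => by
    filter_upwards [(isOpen_lt continuous_const continuous_norm).mem_nhds (hρ.trans_le hy)]
      with z hz
    simp [perturbed, q, hf_zero z (le_of_lt hz)]
  have hJ : (N : ℝ) ^ m * (s⁻¹ * (s ^ m * J)) = N * (δ ^ (m - 1) * J) := by
    obtain ⟨d, rfl⟩ : ∃ d, m = d + 1 := ⟨m - 1, by omega⟩
    have hsN : (N : ℝ) * s = δ := mul_div_cancel₀ _ hN0.ne'
    rw [Nat.add_sub_cancel, ← hsN]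
    field_simp
    ring
  rw [integral_meanCurv_eq S K (contDiff_perturbed hq) hK hf hf_pos hcap hρ hf_zero,
    setIntegral_meanCurv_congr S K hK hfar, integral_curvDensity_packing _ hφ hs hsupp hV, hVcard]
  have hdim' : finrank ℝ (Euc m) = m := by simp
  have hfin : (((N ^ m : ℕ) : ℝ) * (s⁻¹ * (s ^ finrank ℝ (Euc m) * J))) = -(N * b) := by
    rw [hdim', Nat.cast_pow, hJ]
    simp only [b]
    ring
  rw [hfin]
  change c₀ + 2 * -(N * b) < -1
  have : 0 < N * b := by positivity
  linarith
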